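/- Let ϑ_P be a primitive random substitution with Perron–Frobenius eigenvalue λ and right Perron–Frobenius eigenvector R, and let μ_P be its frequency measure on (X_ϑ, S). Then for all k ∈ N, λ^{-k}·H_k^T R − H(λ^{-k}) ≤ h(μ_P) ≤ (λ^k − 1)^{-1}·H_k^T R. In particular, h(μ_P) = lim_{k→∞} λ^{-k}·H_k^T R. -/

import Mathlib

open Filter MeasureTheory

namespace RandomSubstitutionTheory

variable {A : Type*} [Fintype A] [DecidableEq A]

/-- The set of realisations of `ϑ(u)` for a word `u`. -/
def reals (θ : A → Finset (List A)) : List A → Finset (List A)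
  | [] => {[]}
  | a :: u => (θ a).biUnion fun v => (reals θ u).image fun w => v ++ w

/-- The set of realisations of `ϑ^n(u)` for a word `u`. -/
def realsIter (θ : A → Finset (List A)) : ℕ → List A → Finset (List A)
  | 0, u => {u}
  | n + 1, u => (reals θ u).biUnion fun v => realsIter θ n v

/-- `wordProb θ P u w` is the probability `P[ϑ_P(u) = w]`, each letter of `u` being
substituted independently. -/
noncomputable def wordProb (θ : A → Finset (List A)) (P : A → List A → ℝ) :
    List A → List A → ℝ
  | [], w => if w = [] then 1 else 0
  | a :: u, w =>
      ∑ v ∈ θ a, P a v * (if v <+: w then wordProb θ P u (w.drop v.length) else 0)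

/-- `iterProb θ P n u w` is the probability `P[ϑ_P^n(u) = w]` of the induced Markov chain. -/
noncomputable def iterProb (θ : A → Finset (List A)) (P : A → List A → ℝ) :
    ℕ → List A → List A → ℝ
  | 0, u, w => if u = w then 1 else 0
  | n + 1, u, w => ∑ v ∈ reals θ u, wordProb θ P u v * iterProb θ P n v w

/-- The substitution matrix `M_{ij} = E[|ϑ_P(a_j)|_{a_i}]`. -/
noncomputable def substM (θ : A → Finset (List A)) (P : A → List A → ℝ) :
    Matrix A A ℝ :=
  Matrix.of fun i j => ∑ w ∈ θ j, P j w * (w.count i : ℝ)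

/-- The defining data of a random substitution: nonempty finite sets of nonempty words
and strictly positive probability vectors. -/
def IsRandomSubstitution (θ : A → Finset (List A)) (P : A → List A → ℝ) : Prop :=
  (∀ a, (θ a).Nonempty) ∧ (∀ a, ∀ w ∈ θ a, w ≠ []) ∧
    (∀ a, ∀ w ∈ θ a, 0 < P a w) ∧ (∀ a w, w ∉ θ a → P a w = 0) ∧
    ∀ a, ∑ w ∈ θ a, P a w = 1

/-- Primitivity of the substitution matrix: some power has strictly positive entries. -/
def IsPrimitive (θ : A → Finset (List A)) (P : A → List A → ℝ) : Prop :=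
  ∃ k : ℕ, ∀ i j : A, 0 < (substM θ P ^ k) i j

/-- The Perron–Frobenius eigenvalue is `> 1` (witnessed by a positive right eigenvector). -/
def IsExpanding (θ : A → Finset (List A)) (P : A → List A → ℝ) : Prop :=
  ∃ lam : ℝ, 1 < lam ∧ ∃ R : A → ℝ, (∀ a, 0 < R a) ∧ (substM θ P).mulVec R = lam • R

/-- A word is legal if it occurs as a subword of some level-`k` inflation word. -/
def Legal (θ : A → Finset (List A)) (u : List A) : Prop :=
  ∃ (a : A) (k : ℕ) (w : List A), w ∈ realsIter θ k [a] ∧ u <:+: w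

/-- All words of length `n` over the alphabet. -/
def allWords (A : Type*) [Fintype A] [DecidableEq A] (n : ℕ) : Finset (List A) :=
  (Finset.univ : Finset (Fin n → A)).image List.ofFn

/-- All legal words of length `n`. -/
noncomputable def legalWords (θ : A → Finset (List A)) (n : ℕ) : Finset (List A) :=
  letI := Classical.decPred (Legal θ)
  (allWords A n).filter (Legal θ)

/-- The left shift on bi-infinite sequences. -/
def shift : (ℤ → A) → ℤ → A := fun x i => x (i + 1)

/-- The finite word of length `n` read off a bi-infinite sequence starting at position `m`. -/
def window (x : ℤ → A) (m : ℤ) (n : ℕ) : List A :=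
  (List.range n).map fun t => x (m + (t : ℤ))

/-- The random substitution subshift `X_ϑ`. -/
def Xtheta (θ : A → Finset (List A)) : Set (ℤ → A) :=
  {x | ∀ (m : ℤ) (n : ℕ), Legal θ (window x m n)}

/-- The cylinder set of the word `v` at position `m`. -/
def cylinder (v : List A) (m : ℤ) : Set (ℤ → A) :=
  {x | window x m v.length = v}

/-- The number `|w|_v` of (possibly overlapping) occurrences of `v` in `w`. -/
def occCount (v w : List A) : ℕ :=
  ((List.range w.length).filter fun i => decide (v <+: w.drop i)).length

/-- Expected length `E[|ϑ_P^k(a)|]`. -/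
noncomputable def expLen (θ : A → Finset (List A)) (P : A → List A → ℝ)
    (k : ℕ) (a : A) : ℝ :=
  ∑ w ∈ realsIter θ k [a], iterProb θ P k [a] w * (w.length : ℝ)

/-- Expected number of occurrences `E[|ϑ_P^k(a)|_v]`. -/
noncomputable def expCount (θ : A → Finset (List A)) (P : A → List A → ℝ)
    (k : ℕ) (a : A) (v : List A) : ℝ :=
  ∑ w ∈ realsIter θ k [a], iterProb θ P k [a] w * (occCount v w : ℝ)

/-- `μ` is the frequency measure of `(ϑ, P)`: a shift-invariant Borel probability measure
supported on `X_ϑ` whose cylinder values are the expected word frequencies. -/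
def IsFrequencyMeasure [MeasurableSpace A] (θ : A → Finset (List A))
    (P : A → List A → ℝ) (μ : Measure (ℤ → A)) : Prop :=
  IsProbabilityMeasure μ ∧
    (∀ s : Set (ℤ → A), MeasurableSet s → μ (shift ⁻¹' s) = μ s) ∧
    μ (Xtheta θ) = 1 ∧
    ∀ v : List A, Legal θ v → ∀ (m : ℤ) (a : A),
      Tendsto (fun k : ℕ => expCount θ P k a v / expLen θ P k a) atTop
        (nhds ((μ (cylinder v m)).toReal))

/-- The `n`-th entropy sum `∑_{u ∈ L_ϑ^n} -μ[u] log μ[u]`. -/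
noncomputable def entropySeq [MeasurableSpace A] (θ : A → Finset (List A))
    (μ : Measure (ℤ → A)) (n : ℕ) : ℝ :=
  ∑ u ∈ legalWords θ n, Real.negMulLog ((μ (cylinder u 0)).toReal)

/-- The measure-theoretic (Kolmogorov–Sinai) entropy of the shift with respect to `μ`,
computed along cylinder partitions. -/
noncomputable def measEntropy [MeasurableSpace A] (θ : A → Finset (List A))
    (μ : Measure (ℤ → A)) : ℝ :=
  limsup (fun n : ℕ => entropySeq θ μ n / (n : ℝ)) atTop

/-- The topological entropy of the subshift `X_ϑ`. -/
noncomputable def topEntropy (θ : A → Finset (List A)) : ℝ :=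
  limsup (fun n : ℕ => Real.log ((legalWords θ n).card) / (n : ℝ)) atTop

/-- The entropy vector `H_{k,a} = H(ϑ_P^k(a))`. -/
noncomputable def Hvec (θ : A → Finset (List A)) (P : A → List A → ℝ)
    (k : ℕ) (a : A) : ℝ :=
  ∑ w ∈ realsIter θ k [a], Real.negMulLog (iterProb θ P k [a] w)

/-- The inner product `H_k^T R`. -/
noncomputable def HdotR (θ : A → Finset (List A)) (P : A → List A → ℝ)
    (R : A → ℝ) (k : ℕ) : ℝ :=
  ∑ a, Hvec θ P k a * R a

/-- Binary entropy `H(p) = -p log p - (1-p) log (1-p)`. -/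
noncomputable def binEnt (p : ℝ) : ℝ := Real.negMulLog p + Real.negMulLog (1 - p)

/-- Unique realisation paths: concatenation of level-`k` inflation words of the letters of a
legal word is injective. -/
def UniqueRealisationPaths (θ : A → Finset (List A)) : Prop :=
  ∀ v : List A, Legal θ v → ∀ k : ℕ, ∀ f g : Fin v.length → List A,
    (∀ i, f i ∈ realsIter θ k [v.get i]) → (∀ i, g i ∈ realsIter θ k [v.get i]) →
      (List.ofFn f).flatten = (List.ofFn g).flatten → f = g

/-- The disjoint set condition. -/
def DisjointSetCondition (θ : A → Finset (List A)) : Prop :=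
  ∀ (a : A) (k : ℕ), ∀ u ∈ θ a, ∀ v ∈ θ a, u ≠ v →
    ∀ w, w ∈ realsIter θ k u → w ∉ realsIter θ k v

/-- The identical set condition. -/
def IdenticalSetCondition (θ : A → Finset (List A)) : Prop :=
  ∀ (a : A) (k : ℕ), ∀ u ∈ θ a, ∀ v ∈ θ a, realsIter θ k u = realsIter θ k v

/-- Identical production probabilities. -/
def IdenticalProductionProbabilities (θ : A → Finset (List A))
    (P : A → List A → ℝ) : Prop :=
  ∀ a : A, ∀ u ∈ θ a, ∀ v ∈ θ a, ∀ (k : ℕ) (w : List A),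
    iterProb θ P k u w = iterProb θ P k v w

/-- The disjoint set condition for the `k`-th power `ϑ^k`. -/
def DisjointSetConditionPow (θ : A → Finset (List A)) (k : ℕ) : Prop :=
  ∀ (a : A) (j : ℕ), ∀ u ∈ realsIter θ k [a], ∀ v ∈ realsIter θ k [a], u ≠ v →
    ∀ w, w ∈ realsIter θ (k * j) u → w ∉ realsIter θ (k * j) v

/-- The identical set condition for the `k`-th power `ϑ^k`. -/
def IdenticalSetConditionPow (θ : A → Finset (List A)) (k : ℕ) : Prop :=
  ∀ (a : A) (j : ℕ), ∀ u ∈ realsIter θ k [a], ∀ v ∈ realsIter θ k [a],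
    realsIter θ (k * j) u = realsIter θ (k * j) v

/-- Identical production probabilities for the `k`-th power `ϑ^k`. -/
def IdenticalProductionProbabilitiesPow (θ : A → Finset (List A))
    (P : A → List A → ℝ) (k : ℕ) : Prop :=
  ∀ a : A, ∀ u ∈ realsIter θ k [a], ∀ v ∈ realsIter θ k [a], ∀ (j : ℕ) (w : List A),
    iterProb θ P (k * j) u w = iterProb θ P (k * j) v w

/-- Compatibility: all realisations of a letter have the same abelianisation. -/
def Compatible (θ : A → Finset (List A)) : Prop :=
  ∀ a : A, ∀ u ∈ θ a, ∀ v ∈ θ a, ∀ b : A, u.count b = v.count b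

/-- Constant length `ℓ ≥ 2`. -/
def ConstantLength (θ : A → Finset (List A)) (ℓ : ℕ) : Prop :=
  2 ≤ ℓ ∧ ∀ a : A, ∀ w ∈ θ a, w.length = ℓ

/-- The set `ϑ(y)` of bi-infinite sequences obtained by substituting each letter of `y`,
with the image of `y 0` beginning at position `0`. -/
def substSeq (θ : A → Finset (List A)) (y : ℤ → A) : Set (ℤ → A) :=
  {x | ∃ v : ℤ → List A, (∀ j, v j ∈ θ (y j)) ∧
    ∃ p : ℤ → ℤ, p 0 = 0 ∧ (∀ j, p (j + 1) = p j + (v j).length) ∧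
      ∀ (j : ℤ) (t : ℕ) (ht : t < (v j).length), x (p j + (t : ℤ)) = (v j).get ⟨t, ht⟩}

/-- `ϑ(X)` for a set of bi-infinite sequences. -/
def substImage (θ : A → Finset (List A)) (X : Set (ℤ → A)) : Set (ℤ → A) :=
  ⋃ y ∈ X, substSeq θ y

/-- The set `ϑ^m(y)` of bi-infinite sequences. -/
def substSeqPow (θ : A → Finset (List A)) : ℕ → (ℤ → A) → Set (ℤ → A)
  | 0, y => {y}
  | m + 1, y => ⋃ z ∈ substSeq θ y, substSeqPow θ m z

/-- The maximal length of an inflation word of the letter `a` (equals the common length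
when lengths are well-defined). -/
def maxLen (θ : A → Finset (List A)) (a : A) : ℕ := (θ a).sup List.length

/-- Recognisability: every `x ∈ X_ϑ` has a unique inflation-word decomposition. -/
def Recognisable (θ : A → Finset (List A)) : Prop :=
  ∀ x ∈ Xtheta θ, ∃! p : (ℤ → A) × ℕ,
    p.1 ∈ Xtheta θ ∧ p.2 < maxLen θ (p.1 0) ∧
      (fun i => x (i - (p.2 : ℤ))) ∈ substSeq θ p.1

/-- Recognisability of the `m`-th power of a constant length-`ℓ` substitution. -/
def RecognisablePow (θ : A → Finset (List A)) (m ℓ : ℕ) : Prop :=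
  ∀ x ∈ Xtheta θ, ∃! p : (ℤ → A) × ℕ,
    p.1 ∈ Xtheta θ ∧ p.2 < ℓ ^ m ∧
      (fun i => x (i - (p.2 : ℤ))) ∈ substSeqPow θ m p.1

/-- The set `ϑ^m([a])` of exact images of sequences in the cylinder `[a] ⊆ X_ϑ`. -/
def inflCylPow (θ : A → Finset (List A)) (m : ℕ) (a : A) : Set (ℤ → A) :=
  ⋃ y ∈ {w ∈ Xtheta θ | w 0 = a}, substSeqPow θ m y

/-- `r` is a radius of local recognisability for `ϑ^m`. -/
def RecogPropPow (θ : A → Finset (List A)) (m r : ℕ) : Prop :=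
  ∀ (a : A) (x : ℤ → A), x ∈ inflCylPow θ m a → ∀ y ∈ Xtheta θ,
    (∀ t : ℤ, -(r : ℤ) ≤ t → t ≤ (r : ℤ) → x t = y t) → y ∈ inflCylPow θ m a

/-- The recognisability radius `κ(ϑ^m)`. -/
noncomputable def recogRadiusPow (θ : A → Finset (List A)) (m : ℕ) : ℕ :=
  sInf {r | RecogPropPow θ m r}

/-- The recognisability radius `κ(ϑ)`. -/
noncomputable def recogRadius (θ : A → Finset (List A)) : ℕ := recogRadiusPow θ 1

/-- The random word `ϑ_P^n(a)` is (a.s.) completely determined by `ϑ_P^{n+k}(a)`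
in the Markov chain. -/
def DeterminedBy (θ : A → Finset (List A)) (P : A → List A → ℝ)
    (a : A) (n k : ℕ) : Prop :=
  ∀ v₁ v₂ w : List A, v₁ ∈ realsIter θ n [a] → v₂ ∈ realsIter θ n [a] →
    0 < iterProb θ P n [a] v₁ * iterProb θ P k v₁ w →
      0 < iterProb θ P n [a] v₂ * iterProb θ P k v₂ w → v₁ = v₂

/-- The random words `ϑ_P^n(a)` and `ϑ_P^{n+k}(a)` are independent in the Markov chain. -/
def IndepSteps (θ : A → Finset (List A)) (P : A → List A → ℝ)
    (a : A) (n k : ℕ) : Prop :=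
  ∀ v w : List A,
    iterProb θ P n [a] v * iterProb θ P k v w =
      iterProb θ P n [a] v * iterProb θ P (n + k) [a] w

/-- The substitution matrix of a marginal (deterministic) substitution. -/
def marginalM (ρ : A → List A) : Matrix A A ℝ :=
  Matrix.of fun i j => ((ρ j).count i : ℝ)

/-- Geometric compatibility: a single positive left eigenvector with eigenvalue `λ > 1`
for all marginals. -/
def GeometricallyCompatible (θ : A → Finset (List A)) : Prop :=
  ∃ lam : ℝ, 1 < lam ∧ ∃ L : A → ℝ, (∀ a, 0 < L a) ∧
    ∀ ρ : A → List A, (∀ a, ρ a ∈ θ a) → Matrix.vecMul L (marginalM ρ) = lam • L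


set_option linter.unusedSectionVars false

/-! ### Expectations over random words -/

/-- The expectation of `F (ϑ_P(u))`. -/
noncomputable def stepExp (θ : A → Finset (List A)) (P : A → List A → ℝ) :
    List A → (List A → ℝ) → ℝ
  | [], F => F []
  | a :: u, F => ∑ s ∈ θ a, P a s * stepExp θ P u (fun w => F (s ++ w))

/-- The expectation of `F (ϑ_P^n(u))`. -/
noncomputable def iterExp (θ : A → Finset (List A)) (P : A → List A → ℝ) :
    ℕ → List A → (List A → ℝ) → ℝ
  | 0, u, F => F u
  | n + 1, u, F => stepExp θ P u (fun v => iterExp θ P n v F)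

section Expectation

variable {θ : A → Finset (List A)} {P : A → List A → ℝ}

lemma append_mem_reals {a : A} {u s w : List A} (hs : s ∈ θ a) (hw : w ∈ reals θ u) :
    s ++ w ∈ reals θ (a :: u) := by
  simp only [reals, Finset.mem_biUnion, Finset.mem_image]
  exact ⟨s, hs, w, hw, rfl⟩

lemma stepExp_congr {u : List A} {F G : List A → ℝ} (h : ∀ w ∈ reals θ u, F w = G w) :
    stepExp θ P u F = stepExp θ P u G := by
  induction u generalizing F G with
  | nil => exact h [] (by simp [reals])
  | cons a u ih =>
    refine Finset.sum_congr rfl fun s hs => ?_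
    rw [ih fun w hw => h _ (append_mem_reals hs hw)]

lemma stepExp_add (u : List A) (F G : List A → ℝ) :
    stepExp θ P u (fun w => F w + G w) = stepExp θ P u F + stepExp θ P u G := by
  induction u generalizing F G with
  | nil => rfl
  | cons a u ih => simp only [stepExp, ih, mul_add, Finset.sum_add_distrib]

lemma stepExp_mul_left (u : List A) (c : ℝ) (F : List A → ℝ) :
    stepExp θ P u (fun w => c * F w) = c * stepExp θ P u F := by
  induction u generalizing F with
  | nil => rfl
  | cons a u ih => simp only [stepExp, ih, Finset.mul_sum, mul_left_comm]

lemma stepExp_zero (u : List A) : stepExp θ P u (fun _ => 0) = 0 := by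
  simpa using stepExp_mul_left (θ := θ) (P := P) u 0 (fun _ => 0)

lemma stepExp_sum {ι : Type*} (S : Finset ι) (u : List A) (F : ι → List A → ℝ) :
    stepExp θ P u (fun w => ∑ i ∈ S, F i w) = ∑ i ∈ S, stepExp θ P u (F i) := by
  classical
  induction S using Finset.induction_on with
  | empty => simpa using stepExp_zero u
  | insert i S hi ih => simp only [Finset.sum_insert hi, stepExp_add, ih]

lemma stepExp_indicator (u w : List A) :
    stepExp θ P u (fun x => if x = w then 1 else 0) = wordProb θ P u w := by
  induction u generalizing w with
  | nil => simp [stepExp, wordProb, eq_comm]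
  | cons a u ih =>
    refine Finset.sum_congr rfl fun s _ => ?_
    congr 1
    split_ifs with hp
    · obtain ⟨t, rfl⟩ := hp
      rw [List.drop_left, ← ih]
      simp
    · have : (fun x => if s ++ x = w then (1 : ℝ) else 0) = fun _ => 0 :=
        funext fun x => if_neg fun h => hp ⟨x, h⟩
      exact this ▸ stepExp_zero u

lemma sum_wordProb_mul (u : List A) (F : List A → ℝ) :
    ∑ w ∈ reals θ u, wordProb θ P u w * F w = stepExp θ P u F := by
  simp only [← stepExp_indicator, mul_comm _ (F _), ← stepExp_mul_left]
  rw [← stepExp_sum]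
  refine stepExp_congr fun w hw => ?_
  simp [hw]

lemma iterProb_eq_zero {n : ℕ} {u w : List A} (h : w ∉ realsIter θ n u) :
    iterProb θ P n u w = 0 := by
  induction n generalizing u with
  | zero =>
    simp only [realsIter, Finset.mem_singleton] at h
    exact if_neg fun h' => h h'.symm
  | succ n ih =>
    simp only [realsIter, Finset.mem_biUnion, not_exists, not_and] at h
    refine Finset.sum_eq_zero fun v hv => ?_
    rw [ih (h v hv), mul_zero]

lemma sum_iterProb_mul (n : ℕ) (u : List A) (F : List A → ℝ) :
    ∑ w ∈ realsIter θ n u, iterProb θ P n u w * F w = iterExp θ P n u F := by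
  induction n generalizing u with
  | zero => simp [realsIter, iterProb, iterExp]
  | succ n ih =>
    simp only [iterExp, ← sum_wordProb_mul, ← ih, iterProb, Finset.sum_mul]
    rw [Finset.sum_comm]
    refine Finset.sum_congr rfl fun v hv => ?_
    rw [Finset.mul_sum]
    symm
    simp only [← mul_assoc]
    refine Finset.sum_subset (Finset.subset_biUnion_of_mem _ hv) fun w _ hw => ?_
    rw [iterProb_eq_zero hw, mul_zero, zero_mul]

lemma iterExp_congr {n : ℕ} {u : List A} {F G : List A → ℝ}
    (h : ∀ w ∈ realsIter θ n u, F w = G w) : iterExp θ P n u F = iterExp θ P n u G := by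
  simp only [← sum_iterProb_mul]
  exact Finset.sum_congr rfl fun w hw => by rw [h w hw]

lemma iterExp_add (n : ℕ) (u : List A) (F G : List A → ℝ) :
    iterExp θ P n u (fun w => F w + G w) = iterExp θ P n u F + iterExp θ P n u G := by
  simp only [← sum_iterProb_mul, mul_add, Finset.sum_add_distrib]

lemma iterExp_mul_left (n : ℕ) (u : List A) (c : ℝ) (F : List A → ℝ) :
    iterExp θ P n u (fun w => c * F w) = c * iterExp θ P n u F := by
  simp only [← sum_iterProb_mul, Finset.mul_sum, mul_left_comm]

lemma iterExp_sum {ι : Type*} (S : Finset ι) (n : ℕ) (u : List A) (F : ι → List A → ℝ) :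
    iterExp θ P n u (fun w => ∑ i ∈ S, F i w) = ∑ i ∈ S, iterExp θ P n u (F i) := by
  simp only [← sum_iterProb_mul, Finset.mul_sum]
  exact Finset.sum_comm

lemma iterProb_eq_iterExp (n : ℕ) (u w : List A) :
    iterProb θ P n u w = iterExp θ P n u (fun x => if x = w then 1 else 0) := by
  simp only [← sum_iterProb_mul, mul_ite, mul_one, mul_zero, Finset.sum_ite_eq']
  split_ifs with h
  · rfl
  · exact iterProb_eq_zero h

lemma iterExp_comp (m k : ℕ) (u : List A) (F : List A → ℝ) :
    iterExp θ P (m + k) u F = iterExp θ P m u (fun v => iterExp θ P k v F) := by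
  induction m generalizing u with
  | zero => simp [iterExp]
  | succ m ih =>
    rw [Nat.add_right_comm]
    simp only [iterExp, ih]

lemma stepExp_append (u v : List A) (F : List A → ℝ) :
    stepExp θ P (u ++ v) F = stepExp θ P u (fun x => stepExp θ P v (fun y => F (x ++ y))) := by
  induction u generalizing F with
  | nil => simp [stepExp]
  | cons a u ih => simp [stepExp, ih, List.append_assoc]

lemma iterExp_append (n : ℕ) (u v : List A) (F : List A → ℝ) :
    iterExp θ P n (u ++ v) F =
      iterExp θ P n u (fun x => iterExp θ P n v (fun y => F (x ++ y))) := by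
  induction n generalizing u v F with
  | zero => rfl
  | succ n ih =>
    simp only [iterExp, stepExp_append, ih]
    congr 1
    ext x
    simp only [← sum_iterProb_mul (u := x), stepExp_sum, stepExp_mul_left]

lemma iterExp_cons (n : ℕ) (a : A) (v : List A) (F : List A → ℝ) :
    iterExp θ P n (a :: v) F =
      iterExp θ P n [a] (fun x => iterExp θ P n v (fun y => F (x ++ y))) :=
  iterExp_append n [a] v F

lemma iterExp_nil (n : ℕ) (F : List A → ℝ) : iterExp θ P n [] F = F [] := by
  induction n with
  | zero => rfl
  | succ n ih => simpa [iterExp, stepExp] using ih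

lemma stepExp_one (h : IsRandomSubstitution θ P) (u : List A) :
    stepExp θ P u (fun _ => 1) = 1 := by
  induction u with
  | nil => rfl
  | cons a u ih => simp [stepExp, ih, h.2.2.2.2 a]

lemma iterExp_one (h : IsRandomSubstitution θ P) (n : ℕ) (u : List A) :
    iterExp θ P n u (fun _ => 1) = 1 := by
  induction n generalizing u with
  | zero => rfl
  | succ n ih => simp only [iterExp, ih, stepExp_one h]

lemma iterExp_const (h : IsRandomSubstitution θ P) (n : ℕ) (u : List A) (c : ℝ) :
    iterExp θ P n u (fun _ => c) = c := by
  simpa [iterExp_one h] using iterExp_mul_left (θ := θ) (P := P) n u c (fun _ => 1)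

lemma wordProb_nonneg (h : IsRandomSubstitution θ P) (u w : List A) : 0 ≤ wordProb θ P u w := by
  induction u generalizing w with
  | nil => simp only [wordProb]; positivity
  | cons a u ih =>
    refine Finset.sum_nonneg fun s hs => mul_nonneg (h.2.2.1 a s hs).le ?_
    split_ifs
    exacts [ih _, le_rfl]

lemma iterProb_nonneg (h : IsRandomSubstitution θ P) (n : ℕ) (u w : List A) :
    0 ≤ iterProb θ P n u w := by
  induction n generalizing u with
  | zero => simp only [iterProb]; positivity
  | succ n ih => exact Finset.sum_nonneg fun v _ => mul_nonneg (wordProb_nonneg h u v) (ih v)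

lemma wordProb_pos (h : IsRandomSubstitution θ P) {u w : List A} (hw : w ∈ reals θ u) :
    0 < wordProb θ P u w := by
  induction u generalizing w with
  | nil => simp only [reals, Finset.mem_singleton] at hw; simp [wordProb, hw]
  | cons a u ih =>
    simp only [reals, Finset.mem_biUnion, Finset.mem_image] at hw
    obtain ⟨s, hs, x, hx, rfl⟩ := hw
    refine Finset.sum_pos' (fun t ht => mul_nonneg (h.2.2.1 a t ht).le ?_) ⟨s, hs, ?_⟩
    · split_ifs
      exacts [wordProb_nonneg h _ _, le_rfl]
    · simpa using mul_pos (h.2.2.1 a s hs) (ih hx)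

lemma iterProb_pos (h : IsRandomSubstitution θ P) {n : ℕ} {u w : List A}
    (hw : w ∈ realsIter θ n u) : 0 < iterProb θ P n u w := by
  induction n generalizing u with
  | zero => simp only [realsIter, Finset.mem_singleton] at hw; simp [iterProb, hw]
  | succ n ih =>
    simp only [realsIter, Finset.mem_biUnion] at hw
    obtain ⟨v, hv, hw⟩ := hw
    exact Finset.sum_pos' (fun t _ => mul_nonneg (wordProb_nonneg h _ _) (iterProb_nonneg h _ _ _))
      ⟨v, hv, mul_pos (wordProb_pos h hv) (ih hw)⟩

lemma iterExp_mono (h : IsRandomSubstitution θ P) {n : ℕ} {u : List A} {F G : List A → ℝ}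
    (hFG : ∀ w ∈ realsIter θ n u, F w ≤ G w) : iterExp θ P n u F ≤ iterExp θ P n u G := by
  simp only [← sum_iterProb_mul]
  exact Finset.sum_le_sum fun w hw =>
    mul_le_mul_of_nonneg_left (hFG w hw) (iterProb_nonneg h _ _ _)

/-- The probability of a concatenation dominates the product of the probabilities. -/
lemma mul_iterProb_le_iterProb_append (h : IsRandomSubstitution θ P) (n : ℕ)
    (u v x y : List A) :
    iterProb θ P n u x * iterProb θ P n v y ≤ iterProb θ P n (u ++ v) (x ++ y) := by
  rw [iterProb_eq_iterExp n (u ++ v), iterExp_append]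
  simp only [iterProb_eq_iterExp n u, iterProb_eq_iterExp n v]
  rw [mul_comm, ← iterExp_mul_left]
  refine iterExp_mono h fun p _ => ?_
  rw [mul_comm, ← iterExp_mul_left]
  refine iterExp_mono h fun q _ => ?_
  by_cases hp : p = x <;> by_cases hq : q = y <;> simp [hp, hq]
  all_goals positivity

/-- The probability of reaching `w` dominates that of reaching it through `v`. -/
lemma mul_iterProb_le_iterProb_add (h : IsRandomSubstitution θ P) (m k : ℕ)
    (u v w : List A) :
    iterProb θ P m u v * iterProb θ P k v w ≤ iterProb θ P (m + k) u w := by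
  rw [iterProb_eq_iterExp (m + k), iterExp_comp, iterProb_eq_iterExp m, mul_comm,
    ← iterExp_mul_left]
  refine iterExp_mono h fun p _ => ?_
  rw [← iterProb_eq_iterExp]
  split_ifs with hp
  · simp [hp]
  · simpa using iterProb_nonneg h _ _ _

lemma length_le_of_mem_reals (hne : ∀ a, ∀ w ∈ θ a, w ≠ []) {u w : List A}
    (hw : w ∈ reals θ u) : u.length ≤ w.length := by
  induction u generalizing w with
  | nil => simp
  | cons a u ih =>
    simp only [reals, Finset.mem_biUnion, Finset.mem_image] at hw
    obtain ⟨s, hs, x, hx, rfl⟩ := hw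
    have := ih hx
    have := List.length_pos_of_ne_nil (hne a s hs)
    simp only [List.length_cons, List.length_append]
    omega

lemma length_le_of_mem_realsIter (hne : ∀ a, ∀ w ∈ θ a, w ≠ []) {n : ℕ} {u w : List A}
    (hw : w ∈ realsIter θ n u) : u.length ≤ w.length := by
  induction n generalizing u with
  | zero => simp only [realsIter, Finset.mem_singleton] at hw; simp [hw]
  | succ n ih =>
    simp only [realsIter, Finset.mem_biUnion] at hw
    obtain ⟨v, hv, hw⟩ := hw
    exact (length_le_of_mem_reals hne hv).trans (ih hw)

/-- Weighted sum of a letter function over a word. -/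
lemma sum_count_cons (a : A) (u : List A) (g : A → ℝ) :
    ∑ b, ((a :: u).count b : ℝ) * g b = g a + ∑ b, (u.count b : ℝ) * g b := by
  have : ∀ b, ((a :: u).count b : ℝ) * g b =
      (if b = a then g a else 0) + (u.count b : ℝ) * g b := by
    intro b
    rw [List.count_cons]
    by_cases hb : b = a
    · subst hb; simp; ring
    · simp [hb, Ne.symm hb]
  simp only [this, Finset.sum_add_distrib, Finset.sum_ite_eq', Finset.mem_univ, if_true]

lemma stepExp_count (h : IsRandomSubstitution θ P) (u : List A) (b : A) :
    stepExp θ P u (fun w => (w.count b : ℝ)) = ∑ c, (u.count c : ℝ) * substM θ P b c := by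
  induction u with
  | nil => simp [stepExp]
  | cons a u ih =>
    rw [sum_count_cons, ← ih]
    simp only [stepExp, List.count_append, Nat.cast_add, stepExp_add, substM, Matrix.of_apply,
      mul_add, Finset.sum_add_distrib, ← Finset.sum_mul, h.2.2.2.2 a, one_mul]
    congr 1
    refine Finset.sum_congr rfl fun s _ => ?_
    have := stepExp_mul_left (θ := θ) (P := P) u (s.count b : ℝ) (fun _ => 1)
    simp only [mul_one, stepExp_one h] at this
    rw [this]

lemma iterExp_count (h : IsRandomSubstitution θ P) (n : ℕ) (u : List A) (b : A) :
    iterExp θ P n u (fun w => (w.count b : ℝ)) =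
      ∑ c, (u.count c : ℝ) * (substM θ P ^ n) b c := by
  induction n generalizing u with
  | zero => simp [iterExp, Matrix.one_apply]
  | succ n ih =>
    simp only [iterExp, ih, mul_comm _ ((substM θ P ^ n) b _), stepExp_sum, stepExp_mul_left,
      stepExp_count h, pow_succ, Matrix.mul_apply, Finset.mul_sum]
    rw [Finset.sum_comm]
    exact Finset.sum_congr rfl fun c _ => Finset.sum_congr rfl fun d _ => by ring

/-- Averaging over the initial letter with weights given by the right eigenvector. -/
lemma sum_iterExp_count {lam : ℝ} {R : A → ℝ} (h : IsRandomSubstitution θ P)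
    (hEig : (substM θ P).mulVec R = lam • R) (n : ℕ) (b : A) :
    ∑ a, R a * iterExp θ P n [a] (fun w => (w.count b : ℝ)) = lam ^ n * R b := by
  have hpow : (substM θ P ^ n).mulVec R = lam ^ n • R := by
    induction n with
    | zero => simp
    | succ n ih =>
      rw [pow_succ, ← Matrix.mulVec_mulVec, hEig, Matrix.mulVec_smul, ih, smul_smul, pow_succ,
        mul_comm]
  have := congrFun hpow b
  simp only [Matrix.mulVec, dotProduct, Pi.smul_apply, smul_eq_mul] at this
  rw [← this]
  refine Finset.sum_congr rfl fun a _ => ?_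
  rw [iterExp_count h, sum_count_cons]
  simp [mul_comm]

lemma sum_iterExp_sum_count {lam : ℝ} {R : A → ℝ} (h : IsRandomSubstitution θ P)
    (hEig : (substM θ P).mulVec R = lam • R) (n : ℕ) (g : A → ℝ) :
    ∑ a, R a * iterExp θ P n [a] (fun w => ∑ b, (w.count b : ℝ) * g b) =
      lam ^ n * ∑ b, g b * R b := by
  simp only [iterExp_sum, mul_comm _ (g _), iterExp_mul_left, Finset.mul_sum]
  rw [Finset.sum_comm]
  refine Finset.sum_congr rfl fun b _ => ?_
  rw [mul_left_comm, ← sum_iterExp_count h hEig, Finset.mul_sum]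
  exact Finset.sum_congr rfl fun a _ => by ring

lemma sum_count_eq_length (u : List A) : ∑ b, (u.count b : ℝ) = u.length := by
  induction u with
  | nil => simp
  | cons a u ih =>
    have := sum_count_cons a u (fun _ => 1)
    simp only [mul_one, ih] at this
    simp [this, add_comm]

lemma sum_iterExp_length {lam : ℝ} {R : A → ℝ} (h : IsRandomSubstitution θ P)
    (hEig : (substM θ P).mulVec R = lam • R) (hR : ∑ a, R a = 1) (n : ℕ) :
    ∑ a, R a * iterExp θ P n [a] (fun w => (w.length : ℝ)) = lam ^ n := by
  have := sum_iterExp_sum_count h hEig n (fun _ => 1)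
  simpa [sum_count_eq_length, hR] using this

end Expectation

/-! ### Codes built from a dictionary -/

/-- Total weight of the parsings of a word into at most `j` words of the dictionary `D`. -/
noncomputable def parseWeight (D : Finset (List A)) (q : List A → ℝ) : ℕ → List A → ℝ
  | 0, w => if w = [] then 1 else 0
  | j + 1, w => (if w = [] then 1 else 0) +
      ∑ s ∈ D, q s * (if s <+: w then parseWeight D q j (w.drop s.length) else 0)

section Code

variable {D : Finset (List A)} {q : List A → ℝ}

lemma parseWeight_nonneg (hq : ∀ s, 0 ≤ q s) (j : ℕ) (w : List A) : 0 ≤ parseWeight D q j w := by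
  induction j generalizing w with
  | zero => simp only [parseWeight]; positivity
  | succ j ih =>
    refine add_nonneg (by positivity) (Finset.sum_nonneg fun s _ => mul_nonneg (hq s) ?_)
    split_ifs
    exacts [ih _, le_rfl]

lemma parseWeight_mono (hq : ∀ s, 0 ≤ q s) (w : List A) :
    Monotone fun j => parseWeight D q j w := by
  refine monotone_nat_of_le_succ fun j => ?_
  induction j generalizing w with
  | zero =>
    refine le_add_of_nonneg_right (Finset.sum_nonneg fun s _ => mul_nonneg (hq s) ?_)
    split_ifs
    exacts [parseWeight_nonneg hq _ _, le_rfl]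
  | succ j ih =>
    refine add_le_add_right (Finset.sum_le_sum fun s _ => mul_le_mul_of_nonneg_left ?_ (hq s)) _
    split_ifs
    exacts [ih _, le_rfl]

lemma sum_parseWeight_le (hq : ∀ s, 0 ≤ q s) (hD : ∑ s ∈ D, q s ≤ 1 / 2) (j : ℕ)
    (F : Finset (List A)) : ∑ w ∈ F, parseWeight D q j w ≤ 2 := by
  have hnil : ∀ F : Finset (List A), ∑ w ∈ F, (if w = [] then (1 : ℝ) else 0) ≤ 1 := by
    intro F
    rw [Finset.sum_ite_eq']
    split_ifs <;> norm_num
  induction j generalizing F with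
  | zero => exact (hnil F).trans (by norm_num)
  | succ j ih =>
    simp only [parseWeight, Finset.sum_add_distrib]
    rw [Finset.sum_comm]
    have hs : ∀ s ∈ D, ∑ w ∈ F,
        q s * (if s <+: w then parseWeight D q j (w.drop s.length) else 0) ≤ q s * 2 := by
      intro s _
      rw [← Finset.mul_sum, ← Finset.sum_filter]
      refine mul_le_mul_of_nonneg_left ?_ (hq s)
      rw [← Finset.sum_image (f := parseWeight D q j) (g := fun w : List A => w.drop s.length)]
      · exact ih _
      · intro x hx y hy hxy
        obtain ⟨x', rfl⟩ := (Finset.mem_filter.1 hx).2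
        obtain ⟨y', rfl⟩ := (Finset.mem_filter.1 hy).2
        simpa using hxy
    have := Finset.sum_le_sum hs
    rw [← Finset.sum_mul] at this
    linarith [hnil F]

lemma mul_parseWeight_le (hq : ∀ s, 0 ≤ q s) {s : List A} (hs : s ∈ D) (hne : s ≠ [])
    (X : List A) :
    q s * parseWeight D q X.length X ≤ parseWeight D q (s ++ X).length (s ++ X) := by
  obtain ⟨j, hj⟩ : ∃ j, (s ++ X).length = j + 1 :=
    ⟨(s ++ X).length - 1, by
      have := List.length_pos_of_ne_nil hne
      simp only [List.length_append]; omega⟩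
  have hXj : X.length ≤ j := by
    have := List.length_pos_of_ne_nil hne
    simp only [List.length_append] at hj; omega
  rw [hj]
  simp only [parseWeight]
  refine le_add_of_nonneg_of_le (by positivity) ?_
  refine le_trans ?_ (Finset.single_le_sum (f := fun t => q t *
    (if t <+: s ++ X then parseWeight D q j ((s ++ X).drop t.length) else 0))
    (fun t _ => mul_nonneg (hq t) ?_) hs)
  · simpa using mul_le_mul_of_nonneg_left (parseWeight_mono hq X hXj) (hq s)
  · split_ifs
    exacts [parseWeight_nonneg hq _ _, le_rfl]

/-- A code length function for a dictionary `D` with weights `r` together with the letters. -/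
structure IsCode (D : Finset (List A)) (r : List A → ℝ) (Γ : List A → ℝ) : Prop where
  nonneg : ∀ w, 0 ≤ Γ w
  nil_le : Γ [] ≤ Real.log 2
  kraft : ∀ F : Finset (List A), ∑ w ∈ F, Real.exp (-Γ w) ≤ 1
  cons_le : ∀ a X, Γ (a :: X) ≤ Real.log (4 * Fintype.card A) + Γ X
  append_le : ∀ s ∈ D, 0 < r s → ∀ X, Γ (s ++ X) ≤ Real.log 4 - Real.log (r s) + Γ X

lemma exists_isCode (D : Finset (List A)) (r : List A → ℝ) (hr : ∀ s, 0 ≤ r s)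
    (hne : ∀ s ∈ D, s ≠ []) (hsum : ∑ s ∈ D, r s ≤ 1) : ∃ Γ, IsCode D r Γ := by
  set c : ℝ := 1 / (4 * Fintype.card A) with hc
  have hc0 : 0 ≤ c := by positivity
  set q : List A → ℝ := fun s =>
    (if s ∈ D then r s / 4 else 0) + (if s.length = 1 then c else 0) with hqdef
  have hq : ∀ s, 0 ≤ q s := by
    intro s
    have := hr s
    simp only [hqdef]
    positivity
  set E : Finset (List A) := D ∪ Finset.univ.image (fun a : A => [a]) with hE
  have hlen : ∑ s ∈ E, (if s.length = 1 then c else 0) ≤ 1 / 4 := by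
    rw [← Finset.sum_filter, Finset.sum_const, nsmul_eq_mul]
    have hsub : E.filter (fun s => s.length = 1) ⊆ Finset.univ.image (fun a : A => [a]) := by
      intro s hs
      obtain ⟨a, rfl⟩ := List.length_eq_one_iff.1 (Finset.mem_filter.1 hs).2
      simp
    have hcard := (Finset.card_le_card hsub).trans Finset.card_image_le
    have hcard' : ((E.filter fun s => s.length = 1).card : ℝ) ≤ Fintype.card A := by
      exact_mod_cast hcard
    refine (mul_le_mul_of_nonneg_right hcard' hc0).trans ?_
    rcases Nat.eq_zero_or_pos (Fintype.card A) with h0 | h0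
    · simp [h0]
    · have : (0 : ℝ) < Fintype.card A := by exact_mod_cast h0
      rw [hc]
      field_simp
      norm_num
  have hE2 : ∑ s ∈ E, q s ≤ 1 / 2 := by
    simp only [hqdef, Finset.sum_add_distrib]
    have : ∑ s ∈ E, (if s ∈ D then r s / 4 else 0) = (∑ s ∈ D, r s) / 4 := by
      rw [← Finset.sum_filter, Finset.sum_div]
      congr 1
      ext s
      simp only [hE, Finset.mem_filter, Finset.mem_union]
      tauto
    linarith
  have hEne : ∀ s ∈ E, s ≠ [] := by
    intro s hs
    rcases Finset.mem_union.1 hs with h | h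
    · exact hne s h
    · obtain ⟨a, _, rfl⟩ := Finset.mem_image.1 h
      simp
  set Q : List A → ℝ := fun w => parseWeight E q w.length w with hQ
  have happ : ∀ s ∈ E, ∀ X, q s * Q X ≤ Q (s ++ X) := fun s hs X =>
    mul_parseWeight_le hq hs (hEne s hs) X
  have hmem : ∀ a : A, [a] ∈ E := fun a => by simp [hE]
  have hcq : ∀ a : A, c ≤ q [a] := by
    intro a
    have := hr [a]
    simp only [hqdef, List.length_singleton, if_true]
    have : 0 ≤ if [a] ∈ D then r [a] / 4 else 0 := by positivity
    linarith
  have hcpos : ∀ _ : A, 0 < c := by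
    intro a
    have : 0 < Fintype.card A := Fintype.card_pos_iff.2 ⟨a⟩
    positivity
  have hpos : ∀ w, 0 < Q w := by
    intro w
    induction w with
    | nil => simp [hQ, parseWeight]
    | cons a w ih =>
      exact (mul_pos ((hcpos a).trans_le (hcq a)) ih).trans_le (happ [a] (hmem a) w)
  have hsumQ : ∀ F : Finset (List A), ∑ w ∈ F, Q w ≤ 2 := by
    intro F
    refine le_trans (Finset.sum_le_sum fun w hw => ?_)
      (sum_parseWeight_le hq hE2 (F.sup List.length) F)
    exact parseWeight_mono hq w (Finset.le_sup (f := List.length) hw)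
  have hlog : ∀ s X y, 0 < y → y * Q X ≤ Q (s ++ X) →
      Real.log 2 - Real.log (Q (s ++ X)) ≤ -Real.log y + (Real.log 2 - Real.log (Q X)) := by
    intro s X y hy h
    have := Real.log_le_log (mul_pos hy (hpos X)) h
    rw [Real.log_mul hy.ne' (hpos X).ne'] at this
    linarith
  refine ⟨fun w => Real.log 2 - Real.log (Q w), ?_, ?_, ?_, ?_, ?_⟩
  · intro w
    have := hsumQ {w}
    rw [Finset.sum_singleton] at this
    linarith [Real.log_le_log (hpos w) this]
  · simp [hQ, parseWeight]
  · intro F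
    have : ∀ w ∈ F, Real.exp (-(Real.log 2 - Real.log (Q w))) = Q w / 2 := by
      intro w _
      rw [neg_sub, Real.exp_sub, Real.exp_log (hpos w), Real.exp_log two_pos]
    rw [Finset.sum_congr rfl this, ← Finset.sum_div]
    linarith [hsumQ F]
  · intro a X
    have hle : c * Q X ≤ Q ([a] ++ X) :=
      (mul_le_mul_of_nonneg_right (hcq a) (hpos X).le).trans (happ [a] (hmem a) X)
    have := hlog [a] X c (hcpos a) hle
    rwa [hc, one_div, Real.log_inv, neg_neg] at this
  · intro s hs hrs X
    have hle : r s / 4 * Q X ≤ Q (s ++ X) := by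
      refine (mul_le_mul_of_nonneg_right ?_ (hpos X).le).trans
        (happ s (Finset.mem_union_left _ hs) X)
      simp only [hqdef, if_pos hs]
      exact le_add_of_nonneg_right (by positivity)
    have := hlog s X _ (by positivity) hle
    rw [Real.log_div hrs.ne' (by norm_num)] at this
    linarith

end Code

/-! ### Sums over windows -/

lemma mem_allWords {n : ℕ} {w : List A} : w ∈ allWords A n ↔ w.length = n := by
  simp only [allWords, Finset.mem_image, Finset.mem_univ, true_and]
  constructor
  · rintro ⟨f, rfl⟩
    simp
  · rintro rfl
    exact ⟨w.get, List.ofFn_get w⟩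

lemma occCount_nil (v : List A) : occCount v [] = 0 := by simp [occCount]

lemma occCount_cons (v : List A) (a : A) (w : List A) :
    occCount v (a :: w) = (if v <+: a :: w then 1 else 0) + occCount v w := by
  simp only [occCount, List.length_cons, List.range_succ_eq_map, List.filter_cons, List.drop_zero,
    List.filter_map, Function.comp_def, List.drop_succ_cons]
  by_cases h : v <+: a :: w <;> simp [h, add_comm]

lemma infix_of_occCount_ne_zero {v w : List A} (h : occCount v w ≠ 0) : v <:+: w := by
  induction w with
  | nil => exact absurd (occCount_nil v) h
  | cons a w ih =>
    by_cases hp : v <+: a :: w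
    · exact hp.isInfix
    · rw [occCount_cons, if_neg hp, zero_add] at h
      exact (ih h).trans (List.suffix_cons a w).isInfix

/-- The sum of `G` over all windows of length `n` of the word `X`. -/
noncomputable def windowSum (n : ℕ) (G : List A → ℝ) (X : List A) : ℝ :=
  ∑ w ∈ allWords A n, (occCount w X : ℝ) * G w

lemma windowSum_nil (n : ℕ) (G : List A → ℝ) : windowSum n G [] = 0 := by
  simp [windowSum, occCount_nil]

lemma windowSum_cons (n : ℕ) (G : List A → ℝ) (a : A) (X : List A) :
    windowSum n G (a :: X) =
      (if n ≤ (a :: X).length then G ((a :: X).take n) else 0) + windowSum n G X := by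
  simp only [windowSum, occCount_cons, Nat.cast_add, add_mul, Finset.sum_add_distrib]
  congr 1
  split_ifs with h
  · rw [Finset.sum_eq_single ((a :: X).take n)]
    · simp [List.take_prefix]
    · intro w hw hne
      rw [if_neg, Nat.cast_zero, zero_mul]
      intro hp
      rw [List.prefix_iff_eq_take, mem_allWords.1 hw] at hp
      exact hne hp
    · intro hn
      exact absurd (mem_allWords.2 (by simpa using h)) hn
  · refine Finset.sum_eq_zero fun w hw => ?_
    rw [if_neg, Nat.cast_zero, zero_mul]
    intro hp
    exact h (mem_allWords.1 hw ▸ hp.length_le)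

lemma windowSum_nonneg {n : ℕ} {G : List A → ℝ} (hG : ∀ w, 0 ≤ G w) (X : List A) :
    0 ≤ windowSum n G X :=
  Finset.sum_nonneg fun w _ => mul_nonneg (Nat.cast_nonneg _) (hG w)

lemma windowSum_one_le (n : ℕ) (X : List A) : windowSum n (fun _ => 1) X ≤ X.length := by
  induction X with
  | nil => simp [windowSum_nil]
  | cons a X ih =>
    rw [windowSum_cons, List.length_cons, Nat.cast_succ]
    split_ifs <;> linarith

lemma length_sub_le_windowSum_one (n : ℕ) (X : List A) :
    (X.length : ℝ) - n ≤ windowSum n (fun _ => 1) X := by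
  induction X with
  | nil => simp [windowSum_nil]
  | cons a X ih =>
    rw [windowSum_cons]
    split_ifs with h
    · rw [List.length_cons, Nat.cast_succ]
      linarith
    · have h1 : ((a :: X).length : ℝ) ≤ n := by exact_mod_cast (not_le.1 h).le
      have := windowSum_nonneg (n := n) (G := fun _ => 1) (fun _ => zero_le_one) X
      linarith

namespace IsCode

variable {D : Finset (List A)} {r Γ : List A → ℝ}

lemma append_letters_le (h : IsCode D r Γ) (s X : List A) :
    Γ (s ++ X) ≤ s.length * Real.log (4 * Fintype.card A) + Γ X := by
  induction s with
  | nil => simp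
  | cons a s ih =>
    have := h.cons_le a (s ++ X)
    rw [List.cons_append, List.length_cons, Nat.cast_succ]
    linarith

lemma le_letters (h : IsCode D r Γ) (s : List A) :
    Γ s ≤ s.length * Real.log (4 * Fintype.card A) + Real.log 2 := by
  have := h.append_letters_le s []
  rw [List.append_nil] at this
  linarith [h.nil_le]

/-- Averaging over the `n` possible phases bounds the code length of a word by its windows. -/
lemma mul_le_windowSum (h : IsCode D r Γ) (hc : 0 ≤ Real.log (4 * Fintype.card A)) (N : ℕ)
    {G : List A → ℝ} (hG : ∀ w, 0 ≤ G w)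
    (hΓ : ∀ w : List A, w.length = N + 1 → ∀ X, Γ (w ++ X) ≤ G w + Γ X) (X : List A) :
    (N + 1 : ℝ) * Γ X ≤
      (N + 1) * (2 * (N + 1) * Real.log (4 * Fintype.card A) + Real.log 2) +
        windowSum (N + 1) G X := by
  set c := Real.log (4 * Fintype.card A)
  have key : ∀ X : List A, ∑ j ∈ Finset.range (N + 1), Γ (X.drop j) ≤
      (N + 1) * ((N + 1) * c + Real.log 2) + windowSum (N + 1) G X := by
    intro X
    have short : ∀ Y : List A, Y.length ≤ N + 1 →
        ∑ j ∈ Finset.range (N + 1), Γ (Y.drop j) ≤ (N + 1) * ((N + 1) * c + Real.log 2) := by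
      intro Y hY
      have : ∀ j ∈ Finset.range (N + 1), Γ (Y.drop j) ≤ (N + 1) * c + Real.log 2 := by
        intro j _
        have h1 := h.le_letters (Y.drop j)
        have h2 : ((Y.drop j).length : ℝ) ≤ N + 1 := by
          rw [List.length_drop]
          exact_mod_cast (Nat.sub_le _ _).trans hY
        have := mul_le_mul_of_nonneg_right h2 hc
        linarith
      simpa [Finset.sum_add_distrib, mul_add] using Finset.sum_le_sum this
    induction X with
    | nil => simpa [windowSum_nil] using short [] (by simp)
    | cons a X ih =>
      by_cases hlen : N + 1 ≤ (a :: X).length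
      · rw [windowSum_cons, if_pos hlen, Finset.sum_range_succ']
        rw [Finset.sum_range_succ] at ih
        have h1 := hΓ ((a :: X).take (N + 1)) (by simpa using hlen) ((a :: X).drop (N + 1))
        rw [List.take_append_drop] at h1
        simp only [List.drop_succ_cons, List.drop_zero] at h1 ⊢
        linarith
      · have := windowSum_nonneg (n := N + 1) hG (a :: X)
        linarith [short (a :: X) (not_le.1 hlen).le]
  have hsum : ∑ _j ∈ Finset.range (N + 1), Γ X ≤
      ∑ j ∈ Finset.range (N + 1), ((N + 1) * c + Γ (X.drop j)) := by
    refine Finset.sum_le_sum fun j hj => ?_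
    have h1 := h.append_letters_le (X.take j) (X.drop j)
    rw [List.take_append_drop] at h1
    have h2 : ((X.take j).length : ℝ) ≤ N + 1 := by
      have : (X.take j).length ≤ N + 1 :=
        (List.length_take_le _ _).trans (Finset.mem_range.1 hj).le
      exact_mod_cast this
    have := mul_le_mul_of_nonneg_right h2 hc
    linarith
  simp only [Finset.sum_add_distrib, Finset.sum_const, Finset.card_range, nsmul_eq_mul,
    Nat.cast_add, Nat.cast_one] at hsum
  have := key X
  nlinarith

lemma windowSum_append_le (h : IsCode D r Γ) (hc : 0 ≤ Real.log (4 * Fintype.card A)) {n : ℕ}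
    {s : List A} (hs : s.length ≤ n) (X : List A) :
    windowSum n Γ (s ++ X) ≤ s.length * (s.length * Real.log (4 * Fintype.card A)) +
      ∑ d ∈ Finset.range s.length, Γ (X.take (n - 1 - d)) + windowSum n Γ X := by
  set c := Real.log (4 * Fintype.card A)
  induction s with
  | nil => simp
  | cons a s ih =>
    have hs' : s.length + 1 ≤ n := by simpa using hs
    have ih := ih (by omega)
    rw [List.cons_append, windowSum_cons]
    have hwin : (if n ≤ (a :: (s ++ X)).length then Γ ((a :: (s ++ X)).take n) else 0) ≤
        (s.length + 1) * c + Γ (X.take (n - 1 - s.length)) := by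
      have hΓ := h.nonneg (X.take (n - 1 - s.length))
      split_ifs
      · have h1 := h.append_letters_le (a :: s) (X.take (n - 1 - s.length))
        have h2 : (a :: (s ++ X)).take n = (a :: s) ++ X.take (n - 1 - s.length) := by
          rw [← List.cons_append, List.take_append, List.take_of_length_le hs, List.length_cons,
            Nat.sub_sub, Nat.add_comm 1]
        rw [h2]
        simpa using h1
      · positivity
    rw [List.length_cons (a := a) (as := s), Finset.sum_range_succ]
    push_cast
    have : (0 : ℝ) ≤ s.length * c := by positivity
    nlinarith

/-- Prepending a dictionary word `s` raises the total code length of the windows by essentially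
`n` times the code length of `s`. -/
lemma windowSum_add_append_le (h : IsCode D r Γ) (hc : 0 ≤ Real.log (4 * Fintype.card A))
    {n : ℕ} {s : List A} (hs : s.length ≤ n) {x : ℝ} (hx : 0 ≤ x)
    (hsx : ∀ X, Γ (s ++ X) ≤ x + Γ X) (X : List A) :
    windowSum n Γ (s ++ X) + ∑ i ∈ Finset.range n, Γ ((s ++ X).take i) ≤
      windowSum n Γ X + ∑ i ∈ Finset.range n, Γ (X.take i) + n * x +
        s.length * (2 * s.length * Real.log (4 * Fintype.card A) + Real.log 2) := by
  have h1 := h.windowSum_append_le hc hs X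
  set c := Real.log (4 * Fintype.card A)
  obtain ⟨m, rfl⟩ := Nat.exists_eq_add_of_le hs
  have h2 : ∑ i ∈ Finset.range s.length, Γ ((s ++ X).take i) ≤
      s.length * (s.length * c + Real.log 2) := by
    have : ∀ i ∈ Finset.range s.length, Γ ((s ++ X).take i) ≤ s.length * c + Real.log 2 := by
      intro i hi
      have h3 := h.le_letters ((s ++ X).take i)
      have h4 : (((s ++ X).take i).length : ℝ) ≤ s.length := by
        have : ((s ++ X).take i).length ≤ s.length :=
          (List.length_take_le _ _).trans (Finset.mem_range.1 hi).le
        exact_mod_cast this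
      have := mul_le_mul_of_nonneg_right h4 hc
      linarith
    simpa [Finset.sum_add_distrib, mul_add] using Finset.sum_le_sum this
  have h3 : ∑ i ∈ Finset.range m, Γ ((s ++ X).take (s.length + i)) ≤
      m * x + ∑ i ∈ Finset.range m, Γ (X.take i) := by
    have : ∀ i ∈ Finset.range m, Γ ((s ++ X).take (s.length + i)) ≤ x + Γ (X.take i) := by
      intro i _
      rw [List.take_length_add_append]
      exact hsx _
    simpa [Finset.sum_add_distrib] using Finset.sum_le_sum this
  have h4 : ∑ d ∈ Finset.range s.length, Γ (X.take (s.length + m - 1 - d)) =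
      ∑ d ∈ Finset.range s.length, Γ (X.take (m + d)) := by
    rw [← Finset.sum_range_reflect (fun d => Γ (X.take (m + d)))]
    refine Finset.sum_congr rfl fun d hd => ?_
    have := Finset.mem_range.1 hd
    congr 2
    omega
  rw [Finset.sum_range_add (fun i => Γ ((s ++ X).take i)) s.length m, Nat.add_comm s.length m,
    Finset.sum_range_add (fun i => Γ (X.take i)) m s.length]
  rw [Nat.add_comm s.length m] at h1 h4
  push_cast
  have : 0 ≤ s.length * x := by positivity
  nlinarith

end IsCode

/-! ### Entropy estimates for finite words -/

/-- The Gibbs inequality. -/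
lemma sum_negMulLog_le {ι : Type*} (S : Finset ι) (p z : ι → ℝ) (hp : ∀ i ∈ S, 0 ≤ p i)
    (hz : ∀ i ∈ S, 0 < z i) (hsum : ∑ i ∈ S, z i ≤ ∑ i ∈ S, p i) :
    ∑ i ∈ S, Real.negMulLog (p i) ≤ ∑ i ∈ S, p i * -Real.log (z i) := by
  have key : ∀ i ∈ S, Real.negMulLog (p i) ≤ p i * -Real.log (z i) + (z i - p i) := by
    intro i hi
    rcases (hp i hi).eq_or_lt with h0 | h0
    · simpa [← h0] using (hz i hi).le
    · have h1 := mul_le_mul_of_nonneg_left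
        (Real.log_le_sub_one_of_pos (div_pos (hz i hi) h0)) h0.le
      rw [Real.log_div (hz i hi).ne' h0.ne', mul_sub, mul_sub, mul_div_cancel₀ _ h0.ne'] at h1
      rw [Real.negMulLog]
      linarith
  have := Finset.sum_le_sum key
  rw [Finset.sum_add_distrib, Finset.sum_sub_distrib] at this
  linarith

section WordEntropy

variable {θ : A → Finset (List A)} {P : A → List A → ℝ}

lemma iterExp_const_add (h : IsRandomSubstitution θ P) (n : ℕ) (u : List A) (c : ℝ)
    (F : List A → ℝ) : iterExp θ P n u (fun w => c + F w) = c + iterExp θ P n u F := by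
  rw [iterExp_add n u (fun _ => c) F, iterExp_const h]

lemma mem_realsIter_of_iterProb_pos {n : ℕ} {u w : List A} (h : 0 < iterProb θ P n u w) :
    w ∈ realsIter θ n u := by
  by_contra hw
  exact h.ne' (iterProb_eq_zero hw)

lemma append_mem_realsIter (h : IsRandomSubstitution θ P) {n : ℕ} {u v x y : List A}
    (hx : x ∈ realsIter θ n u) (hy : y ∈ realsIter θ n v) :
    x ++ y ∈ realsIter θ n (u ++ v) :=
  mem_realsIter_of_iterProb_pos (P := P) <|
    (mul_pos (iterProb_pos h hx) (iterProb_pos h hy)).trans_le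
      (mul_iterProb_le_iterProb_append h n u v x y)

lemma Hvec_eq_iterExp (k : ℕ) (a : A) :
    Hvec θ P k a = iterExp θ P k [a] (fun w => -Real.log (iterProb θ P k [a] w)) := by
  rw [← sum_iterProb_mul]
  exact Finset.sum_congr rfl fun w _ => by rw [Real.negMulLog]; ring

lemma iterProb_le_one (h : IsRandomSubstitution θ P) (n : ℕ) (u w : List A) :
    iterProb θ P n u w ≤ 1 := by
  rw [iterProb_eq_iterExp]
  refine (iterExp_mono (G := fun _ => 1) h fun x _ => ?_).trans_eq (iterExp_one h n u)
  split_ifs <;> norm_num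

/-- The entropy of the image of a word is at most the sum of those of the images of its letters. -/
lemma iterExp_neg_log_iterProb_le (h : IsRandomSubstitution θ P) (k : ℕ) (u : List A) :
    iterExp θ P k u (fun w => -Real.log (iterProb θ P k u w)) ≤
      ∑ b, (u.count b : ℝ) * Hvec θ P k b := by
  induction u with
  | nil =>
    rw [iterExp_nil, iterProb_eq_iterExp, iterExp_nil]
    simp
  | cons a u ih =>
    rw [sum_count_cons, Hvec_eq_iterExp, iterExp_cons]
    calc _ ≤ iterExp θ P k [a] (fun x => iterExp θ P k u (fun y =>
          -Real.log (iterProb θ P k [a] x) + -Real.log (iterProb θ P k u y))) := by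
          refine iterExp_mono h fun x hx => iterExp_mono h fun y hy => ?_
          have hx' := iterProb_pos h hx
          have hy' := iterProb_pos h hy
          have := Real.log_le_log (mul_pos hx' hy')
            (mul_iterProb_le_iterProb_append h k [a] u x y)
          rw [Real.log_mul hx'.ne' hy'.ne', List.singleton_append] at this
          linarith
      _ = iterExp θ P k [a] (fun x => -Real.log (iterProb θ P k [a] x)) +
          iterExp θ P k u (fun y => -Real.log (iterProb θ P k u y)) := by
          simp only [iterExp_const_add h, iterExp_add, iterExp_const h]
      _ ≤ _ := by linarith

lemma HdotR_add_le {lam : ℝ} {R : A → ℝ} (h : IsRandomSubstitution θ P)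
    (hEig : (substM θ P).mulVec R = lam • R) (hR : ∀ a, 0 < R a) (m k : ℕ) :
    HdotR θ P R (m + k) ≤ HdotR θ P R m + lam ^ m * HdotR θ P R k := by
  unfold HdotR
  rw [← sum_iterExp_sum_count h hEig, ← Finset.sum_add_distrib]
  refine Finset.sum_le_sum fun a _ => ?_
  rw [mul_comm, mul_comm _ (R a), ← mul_add]
  refine mul_le_mul_of_nonneg_left ?_ (hR a).le
  rw [Hvec_eq_iterExp, Hvec_eq_iterExp, iterExp_comp, ← iterExp_add]
  refine iterExp_mono h fun u hu => ?_
  refine le_trans ?_ (add_le_add_right (iterExp_neg_log_iterProb_le h k u) _)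
  rw [← iterExp_const_add h]
  refine iterExp_mono h fun w hw => ?_
  have hu' := iterProb_pos h hu
  have hw' := iterProb_pos h hw
  have := Real.log_le_log (mul_pos hu' hw') (mul_iterProb_le_iterProb_add h m k [a] u w)
  rw [Real.log_mul hu'.ne' hw'.ne'] at this
  linarith

end WordEntropy

/-- The sum of `g` over all concatenations of level-`k` inflation words of the letters of a word,
counted with multiplicity. -/
noncomputable def parsingSum (θ : A → Finset (List A)) (k : ℕ) :
    List A → (List A → ℝ) → ℝ
  | [], g => g []
  | a :: u, g => ∑ s ∈ realsIter θ k [a], parsingSum θ k u (fun X => g (s ++ X))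

section Parsing

variable {θ : A → Finset (List A)} {P : A → List A → ℝ} {k : ℕ}

lemma parsingSum_congr (h : IsRandomSubstitution θ P) {u : List A} {f g : List A → ℝ}
    (hfg : ∀ X ∈ realsIter θ k u, f X = g X) : parsingSum θ k u f = parsingSum θ k u g := by
  induction u generalizing f g with
  | nil =>
    refine hfg [] (mem_realsIter_of_iterProb_pos (P := P) ?_)
    rw [iterProb_eq_iterExp, iterExp_nil]
    simp
  | cons a u ih =>
    exact Finset.sum_congr rfl fun s hs => ih fun X hX => hfg _ (append_mem_realsIter h hs hX)

lemma parsingSum_mul_left (u : List A) (c : ℝ) (f : List A → ℝ) :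
    parsingSum θ k u (fun X => c * f X) = c * parsingSum θ k u f := by
  induction u generalizing f with
  | nil => rfl
  | cons a u ih => simp only [parsingSum, ih, Finset.mul_sum]

lemma parsingSum_zero (u : List A) : parsingSum θ k u (fun _ => 0) = 0 := by
  simpa using parsingSum_mul_left (θ := θ) (k := k) u 0 (fun _ => 0)

lemma parsingSum_sum {ι : Type*} (S : Finset ι) (u : List A) (F : ι → List A → ℝ) :
    parsingSum θ k u (fun X => ∑ i ∈ S, F i X) = ∑ i ∈ S, parsingSum θ k u (F i) := by
  induction u generalizing F with
  | nil => rfl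
  | cons a u ih =>
    simp only [parsingSum, ih]
    exact Finset.sum_comm

lemma realsIter_nonempty (h : IsRandomSubstitution θ P) (k : ℕ) (u : List A) :
    (realsIter θ k u).Nonempty := by
  by_contra hne
  have := iterExp_one h k u
  rw [← sum_iterProb_mul, Finset.not_nonempty_iff_eq_empty.1 hne] at this
  simp at this

lemma parsingSum_pos (h : IsRandomSubstitution θ P) (u : List A) {g : List A → ℝ}
    (hg : ∀ X, 0 < g X) : 0 < parsingSum θ k u g := by
  induction u generalizing g with
  | nil => exact hg []
  | cons a u ih =>
    exact Finset.sum_pos (fun s _ => ih fun X => hg _) (realsIter_nonempty h k [a])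

/-- The Gibbs inequality for the independent family of images of the letters of `u`. -/
lemma sum_Hvec_sub_log_le (h : IsRandomSubstitution θ P) (u : List A) {g : List A → ℝ}
    (hg : ∀ X, 0 < g X) :
    ∑ b, (u.count b : ℝ) * Hvec θ P k b - Real.log (parsingSum θ k u g) ≤
      iterExp θ P k u (fun X => -Real.log (g X)) := by
  induction u generalizing g with
  | nil => simp [iterExp_nil, parsingSum]
  | cons a u ih =>
    rw [sum_count_cons, iterExp_cons]
    set z : List A → ℝ := fun s => parsingSum θ k u (fun X => g (s ++ X)) with hz
    have hzpos : ∀ s, 0 < z s := fun s => parsingSum_pos h u fun X => hg _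
    have hZ : parsingSum θ k (a :: u) g = ∑ s ∈ realsIter θ k [a], z s := rfl
    have hZpos : 0 < ∑ s ∈ realsIter θ k [a], z s := hZ ▸ parsingSum_pos h (a :: u) hg
    set Z := ∑ s ∈ realsIter θ k [a], z s with hZdef
    have hone : ∑ s ∈ realsIter θ k [a], iterProb θ P k [a] s = 1 := by
      simpa [← sum_iterProb_mul] using iterExp_one h k [a]
    have hgibbs := sum_negMulLog_le (realsIter θ k [a]) (iterProb θ P k [a]) (fun s => z s / Z)
      (fun s _ => iterProb_nonneg h _ _ _) (fun s _ => div_pos (hzpos s) hZpos)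
      (by rw [← Finset.sum_div, div_self hZpos.ne', hone])
    have hlog : ∀ s, -Real.log (z s / Z) = Real.log Z + -Real.log (z s) := fun s => by
      rw [Real.log_div (hzpos s).ne' hZpos.ne']; ring
    simp only [hlog] at hgibbs
    rw [sum_iterProb_mul, iterExp_const_add h] at hgibbs
    have hih : iterExp θ P k [a] (fun s =>
        ∑ b, (u.count b : ℝ) * Hvec θ P k b + -Real.log (z s)) ≤
        iterExp θ P k [a] (fun s => iterExp θ P k u (fun X => -Real.log (g (s ++ X)))) := by
      refine iterExp_mono h fun s _ => ?_
      linarith [ih (g := fun X => g (s ++ X)) fun X => hg _]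
    rw [iterExp_const_add h] at hih
    rw [hZ]
    unfold Hvec at hih ⊢
    linarith

lemma parsingSum_indicator_le (h : IsRandomSubstitution θ P) {α β : ℝ}
    (hαβ : ∀ T : ℕ, ∑ t ∈ Finset.range T, Real.exp (-(α + t * β)) ≤ 1) (u W : List A) :
    parsingSum θ k u (fun X => if X = W then
      Real.exp (-(u.length * α + (X.length - u.length) * β)) else 0) ≤ 1 := by
  induction u generalizing W with
  | nil =>
    simp only [parsingSum]
    split_ifs <;> simp
  | cons a u ih =>
    have hterm : ∀ s ∈ realsIter θ k [a], parsingSum θ k u (fun X => if s ++ X = W then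
        Real.exp (-((a :: u).length * α + ((s ++ X).length - (a :: u).length) * β)) else 0) ≤
        if s <+: W then Real.exp (-(α + ((s.length - 1 : ℕ) : ℝ) * β)) else 0 := by
      intro s hs
      have hlen : 1 ≤ s.length := length_le_of_mem_realsIter h.2.1 hs
      split_ifs with hp
      · obtain ⟨Y, rfl⟩ := hp
        refine le_trans (le_of_eq ?_) (mul_le_of_le_one_right (Real.exp_pos _).le (ih Y))
        rw [← parsingSum_mul_left]
        congr 1
        ext X
        by_cases hX : X = Y
        · subst hX
          simp only [if_true, ← Real.exp_add]
          congr 1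
          simp only [List.length_append, List.length_cons]
          push_cast [Nat.cast_sub hlen]
          ring
        · simp [hX]
      · refine le_of_eq ?_
        rw [← parsingSum_zero (θ := θ) (k := k) u]
        congr 1
        ext X
        rw [parsingSum_zero]
        exact if_neg fun hX => hp ⟨X, hX⟩
    refine (Finset.sum_le_sum hterm).trans ?_
    rw [← Finset.sum_filter]
    have hinj : Set.InjOn (fun s : List A => s.length - 1)
        ((realsIter θ k [a]).filter (fun s => s <+: W)) := by
      intro s hs t ht hst
      obtain ⟨hs, hsW⟩ := Finset.mem_filter.1 hs
      obtain ⟨ht, htW⟩ := Finset.mem_filter.1 ht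
      have h1 : 1 ≤ s.length := length_le_of_mem_realsIter h.2.1 hs
      have h2 : 1 ≤ t.length := length_le_of_mem_realsIter h.2.1 ht
      have : s.length = t.length := by
        simp only at hst
        omega
      exact (List.prefix_of_prefix_length_le hsW htW this.le).eq_of_length this
    rw [← Finset.sum_image (f := fun t : ℕ => Real.exp (-(α + t * β))) hinj]
    refine le_trans (Finset.sum_le_sum_of_subset_of_nonneg ?_ fun _ _ _ => (Real.exp_pos _).le)
      (hαβ (W.length + 1))
    intro t ht
    obtain ⟨s, hs, rfl⟩ := Finset.mem_image.1 ht
    have := (Finset.mem_filter.1 hs).2.length_le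
    simp only [Finset.mem_range]
    omega

/-- Coding the images of the letters of `u` by the code `Γ` and the boundary marks. -/
lemma sum_Hvec_le (h : IsRandomSubstitution θ P) {α β : ℝ}
    (hαβ : ∀ T : ℕ, ∑ t ∈ Finset.range T, Real.exp (-(α + t * β)) ≤ 1)
    {Γ : List A → ℝ} (hΓ : ∀ F : Finset (List A), ∑ w ∈ F, Real.exp (-Γ w) ≤ 1) (u : List A) :
    ∑ b, (u.count b : ℝ) * Hvec θ P k b ≤
      iterExp θ P k u (fun X => Γ X + (u.length * α + (X.length - u.length) * β)) := by
  set g : List A → ℝ := fun X =>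
    Real.exp (-(Γ X + (u.length * α + (X.length - u.length) * β))) with hg
  have hle : parsingSum θ k u g ≤ 1 := by
    have : parsingSum θ k u g = parsingSum θ k u (fun X => ∑ W ∈ realsIter θ k u,
        Real.exp (-Γ W) * (if X = W then
          Real.exp (-(u.length * α + (X.length - u.length) * β)) else 0)) := by
      refine parsingSum_congr h fun X hX => ?_
      simp only [mul_ite, mul_zero, Finset.sum_ite_eq, if_pos hX, hg, ← Real.exp_add]
      congr 1
      ring
    rw [this, parsingSum_sum]
    refine le_trans (Finset.sum_le_sum fun W _ => ?_) (hΓ (realsIter θ k u))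
    rw [parsingSum_mul_left]
    exact mul_le_of_le_one_right (Real.exp_pos _).le (parsingSum_indicator_le h hαβ u W)
  have hlog := Real.log_nonpos (parsingSum_pos (k := k) h u fun X => Real.exp_pos _).le hle
  have := sum_Hvec_sub_log_le (k := k) h u (g := g) fun X => Real.exp_pos _
  simp only [hg, Real.log_exp, neg_neg] at this hlog
  linarith

/-- Total code length of the windows of the image of a word. -/
lemma iterExp_windowSum_le (h : IsRandomSubstitution θ P) {D : Finset (List A)}
    {r Γ : List A → ℝ} (hΓ : IsCode D r Γ) (hc : 0 ≤ Real.log (4 * Fintype.card A)) {n L : ℕ}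
    (hD : ∀ a, realsIter θ k [a] ⊆ D)
    (hr : ∀ a, ∀ s ∈ realsIter θ k [a], iterProb θ P k [a] s / Fintype.card A ≤ r s)
    (hL : ∀ a, ∀ s ∈ realsIter θ k [a], s.length ≤ L) (hLn : L ≤ n) (u : List A) :
    iterExp θ P k u (windowSum n Γ) ≤ n * Real.log 2 +
      ∑ b, (u.count b : ℝ) * (n * (Real.log (4 * Fintype.card A) + Hvec θ P k b) +
        L * (2 * L * Real.log (4 * Fintype.card A) + Real.log 2)) := by
  set c := Real.log (4 * Fintype.card A) with hcdef
  set K : ℝ := L * (2 * L * c + Real.log 2) with hK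
  suffices H : iterExp θ P k u
      (fun X => windowSum n Γ X + ∑ i ∈ Finset.range n, Γ (X.take i)) ≤
      n * Real.log 2 + ∑ b, (u.count b : ℝ) * (n * (c + Hvec θ P k b) + K) by
    refine le_trans (iterExp_mono h fun X _ => ?_) H
    exact le_add_of_nonneg_right (Finset.sum_nonneg fun i _ => hΓ.nonneg _)
  induction u with
  | nil =>
    rw [iterExp_nil, windowSum_nil]
    have : ∀ i ∈ Finset.range n, Γ (([] : List A).take i) ≤ Real.log 2 := by
      intro i _
      simpa using hΓ.nil_le
    simpa using Finset.sum_le_sum this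
  | cons a u ih =>
    rw [sum_count_cons, iterExp_cons]
    have hstep : ∀ s ∈ realsIter θ k [a], iterExp θ P k u (fun X =>
        windowSum n Γ (s ++ X) + ∑ i ∈ Finset.range n, Γ ((s ++ X).take i)) ≤
        (n * Real.log 2 + ∑ b, (u.count b : ℝ) * (n * (c + Hvec θ P k b) + K) + n * c + K) +
          n * -Real.log (iterProb θ P k [a] s) := by
      intro s hs
      have hpos := iterProb_pos h hs
      have hcard : (0 : ℝ) < Fintype.card A := by
        exact_mod_cast Fintype.card_pos_iff.2 ⟨a⟩
      have hrs := hr a s hs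
      have hrpos : 0 < r s := (div_pos hpos hcard).trans_le hrs
      set x := c - Real.log (iterProb θ P k [a] s) with hx
      have hx0 : 0 ≤ x := by
        have := Real.log_nonpos hpos.le (iterProb_le_one h k [a] s)
        linarith
      have hsx : ∀ X, Γ (s ++ X) ≤ x + Γ X := by
        intro X
        have h1 := hΓ.append_le s (hD a hs) hrpos X
        have h2 := Real.log_le_log (div_pos hpos hcard) hrs
        rw [Real.log_div hpos.ne' hcard.ne'] at h2
        rw [hx, hcdef, Real.log_mul (by norm_num) hcard.ne']
        linarith
      have hsL : (s.length : ℝ) ≤ L := by exact_mod_cast hL a s hs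
      have hlog2 : 0 ≤ Real.log 2 := Real.log_nonneg (by norm_num)
      have hKs : s.length * (2 * s.length * c + Real.log 2) ≤ K := by
        rw [hK]
        gcongr
      have hmono : iterExp θ P k u (fun X =>
          windowSum n Γ (s ++ X) + ∑ i ∈ Finset.range n, Γ ((s ++ X).take i)) ≤
          iterExp θ P k u (fun X => (n * x + K) +
            (windowSum n Γ X + ∑ i ∈ Finset.range n, Γ (X.take i))) := by
        refine iterExp_mono h fun X _ => ?_
        have := hΓ.windowSum_add_append_le hc ((hL a s hs).trans hLn) hx0 hsx X
        linarith
      rw [iterExp_const_add h] at hmono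
      have : (n : ℝ) * x = n * c + n * -Real.log (iterProb θ P k [a] s) := by rw [hx]; ring
      linarith
    refine (iterExp_mono h hstep).trans (le_of_eq ?_)
    rw [iterExp_const_add h, iterExp_mul_left, ← Hvec_eq_iterExp]
    ring

end Parsing

/-! ### Averages with respect to the right eigenvector -/

/-- The expectation of `F (ϑ_P^m(a))` for a random letter `a` with distribution `R`. -/
noncomputable def avgExp (θ : A → Finset (List A)) (P : A → List A → ℝ) (R : A → ℝ) (m : ℕ)
    (F : List A → ℝ) : ℝ :=
  ∑ a, R a * iterExp θ P m [a] F

section Average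

variable {θ : A → Finset (List A)} {P : A → List A → ℝ} {R : A → ℝ}

lemma avgExp_add (m : ℕ) (F G : List A → ℝ) :
    avgExp θ P R m (fun w => F w + G w) = avgExp θ P R m F + avgExp θ P R m G := by
  simp only [avgExp, iterExp_add, mul_add, Finset.sum_add_distrib]

lemma avgExp_mul_left (m : ℕ) (c : ℝ) (F : List A → ℝ) :
    avgExp θ P R m (fun w => c * F w) = c * avgExp θ P R m F := by
  simp only [avgExp, iterExp_mul_left, Finset.mul_sum, mul_left_comm]

lemma avgExp_const (h : IsRandomSubstitution θ P) (hR : ∑ a, R a = 1) (m : ℕ) (c : ℝ) :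
    avgExp θ P R m (fun _ => c) = c := by
  simp only [avgExp, iterExp_const h, ← Finset.sum_mul, hR, one_mul]

lemma avgExp_mono (h : IsRandomSubstitution θ P) (hR : ∀ a, 0 < R a) {m : ℕ}
    {F G : List A → ℝ} (hFG : ∀ w, F w ≤ G w) : avgExp θ P R m F ≤ avgExp θ P R m G :=
  Finset.sum_le_sum fun a _ =>
    mul_le_mul_of_nonneg_left (iterExp_mono h fun w _ => hFG w) (hR a).le

lemma avgExp_comp (m k : ℕ) (F : List A → ℝ) :
    avgExp θ P R (m + k) F = avgExp θ P R m (fun u => iterExp θ P k u F) := by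
  simp only [avgExp, iterExp_comp]

/-- The average number of occurrences of `w` in a level-`K` inflation word, normalised. -/
noncomputable def avgFreq (θ : A → Finset (List A)) (P : A → List A → ℝ) (R : A → ℝ) (lam : ℝ)
    (K : ℕ) (w : List A) : ℝ :=
  avgExp θ P R K (fun X => (occCount w X : ℝ)) / lam ^ K

lemma avgExp_windowSum {lam : ℝ} (hlam : 1 < lam) (K n : ℕ) (G : List A → ℝ) :
    avgExp θ P R K (windowSum n G) =
      lam ^ K * ∑ w ∈ allWords A n, avgFreq θ P R lam K w * G w := by
  have hpos : lam ^ K ≠ 0 := (pow_pos (zero_lt_one.trans hlam) K).ne'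
  have h1 : ∀ w, lam ^ K * (avgFreq θ P R lam K w * G w) =
      ∑ a, R a * iterExp θ P K [a] (fun X => (occCount w X : ℝ) * G w) := by
    intro w
    have : ∀ a, R a * iterExp θ P K [a] (fun X => (occCount w X : ℝ) * G w) =
        R a * iterExp θ P K [a] (fun X => (occCount w X : ℝ)) * G w := by
      intro a
      simp only [mul_comm _ (G w), iterExp_mul_left]
      ring
    simp only [this, ← Finset.sum_mul]
    rw [avgFreq, ← avgExp, ← mul_assoc, mul_div_cancel₀ _ hpos]
  rw [Finset.mul_sum, Finset.sum_congr rfl fun w _ => h1 w, Finset.sum_comm]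
  refine Finset.sum_congr rfl fun a _ => ?_
  rw [← Finset.mul_sum, ← iterExp_sum]
  rfl

/-- The frequency of a word, as given by the measure `μ`. -/
noncomputable def freq [MeasurableSpace A] (θ : A → Finset (List A)) (μ : Measure (ℤ → A))
    (w : List A) : ℝ :=
  letI := Classical.dec (Legal θ w)
  if Legal θ w then (μ (cylinder w 0)).toReal else 0

lemma freq_nonneg [MeasurableSpace A] (μ : Measure (ℤ → A)) (w : List A) :
    0 ≤ freq θ μ w := by
  unfold freq
  split_ifs
  exacts [ENNReal.toReal_nonneg, le_rfl]

lemma entropySeq_eq [MeasurableSpace A] (μ : Measure (ℤ → A)) (n : ℕ) :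
    entropySeq θ μ n = ∑ w ∈ allWords A n, Real.negMulLog (freq θ μ w) := by
  classical
  unfold entropySeq legalWords
  rw [Finset.sum_filter]
  refine Finset.sum_congr rfl fun w _ => ?_
  unfold freq
  split_ifs <;> simp

lemma tendsto_avgFreq [MeasurableSpace A] {lam : ℝ} {μ : Measure (ℤ → A)}
    (h : IsRandomSubstitution θ P) (hlam : 1 < lam) (hRpos : ∀ a, 0 < R a)
    (hR : ∑ a, R a = 1) (hEig : (substM θ P).mulVec R = lam • R)
    (hμ : IsFrequencyMeasure θ P μ) (w : List A) :
    Tendsto (fun K => avgFreq θ P R lam K w) atTop (nhds (freq θ μ w)) := by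
  have hcount : ∀ K a, expCount θ P K a w = iterExp θ P K [a] (fun X => (occCount w X : ℝ)) :=
    fun K a => sum_iterProb_mul K [a] _
  by_cases hw : Legal θ w
  · have hlen : ∀ K a, expLen θ P K a = iterExp θ P K [a] (fun X => (X.length : ℝ)) :=
      fun K a => sum_iterProb_mul K [a] _
    have hlenpos : ∀ K a, 0 < expLen θ P K a := by
      intro K a
      rw [hlen]
      refine zero_lt_one.trans_le ((iterExp_one h K [a]).symm.trans_le (iterExp_mono h ?_))
      intro X hX
      have : 1 ≤ X.length := length_le_of_mem_realsIter h.2.1 hX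
      exact_mod_cast this
    have hfreq : freq θ μ w = (μ (cylinder w 0)).toReal := if_pos hw
    have hlim := hμ.2.2.2 w hw 0
    rw [← hfreq] at hlim
    set f := freq θ μ w
    have hpos : ∀ K, 0 < lam ^ K := fun K => pow_pos (zero_lt_one.trans hlam) K
    have hsum : ∀ K, ∑ a, R a * expLen θ P K a = lam ^ K := by
      intro K
      simp only [hlen]
      exact sum_iterExp_length h hEig hR K
    rw [tendsto_iff_norm_sub_tendsto_zero]
    have hbound : Tendsto (fun K => ∑ a, ‖expCount θ P K a w / expLen θ P K a - f‖) atTop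
        (nhds 0) := by
      have := tendsto_finsetSum (Finset.univ : Finset A) fun a _ =>
        tendsto_iff_norm_sub_tendsto_zero.1 (hlim a)
      simpa using this
    refine squeeze_zero (fun _ => norm_nonneg _) (fun K => ?_) hbound
    have hrepr : avgFreq θ P R lam K w - f =
        ∑ a, R a * expLen θ P K a / lam ^ K * (expCount θ P K a w / expLen θ P K a - f) := by
      have h1 : ∀ a, R a * expLen θ P K a / lam ^ K * (expCount θ P K a w / expLen θ P K a - f) =
          R a * expCount θ P K a w / lam ^ K - R a * expLen θ P K a / lam ^ K * f := by
        intro a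
        have := (hlenpos K a).ne'
        have := (hpos K).ne'
        field_simp
      rw [Finset.sum_congr rfl fun a _ => h1 a]
      simp only [Finset.sum_sub_distrib, ← Finset.sum_mul, ← Finset.sum_div, hsum,
        div_self (hpos K).ne', one_mul, hcount]
      rfl
    rw [hrepr]
    refine (norm_sum_le _ _).trans (Finset.sum_le_sum fun a _ => ?_)
    rw [norm_mul]
    refine mul_le_of_le_one_left (norm_nonneg _) ?_
    have hnn : 0 ≤ R a * expLen θ P K a := (mul_pos (hRpos a) (hlenpos K a)).le
    rw [Real.norm_of_nonneg (div_nonneg hnn (hpos K).le), div_le_one (hpos K), ← hsum K]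
    exact Finset.single_le_sum (f := fun b => R b * expLen θ P K b)
      (fun b _ => (mul_pos (hRpos b) (hlenpos K b)).le) (Finset.mem_univ a)
  · have hfreq : freq θ μ w = 0 := if_neg hw
    have hzero : ∀ K, avgFreq θ P R lam K w = 0 := by
      intro K
      have : ∀ a, iterExp θ P K [a] (fun X => (occCount w X : ℝ)) = 0 := by
        intro a
        rw [← iterExp_const h K [a] 0]
        refine iterExp_congr fun X hX => ?_
        by_contra hne
        exact hw ⟨a, K, X, hX, infix_of_occCount_ne_zero fun h0 => hne (by simp [h0])⟩
      simp [avgFreq, avgExp, this]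
    simp only [hzero, hfreq]
    exact tendsto_const_nhds

end Average

/-! ### The main estimates -/

section Main

variable [MeasurableSpace A] {θ : A → Finset (List A)} {P : A → List A → ℝ} {R : A → ℝ}
  {lam : ℝ} {μ : Measure (ℤ → A)}

lemma tendsto_sum_avgFreq_mul (h : IsRandomSubstitution θ P) (hlam : 1 < lam)
    (hRpos : ∀ a, 0 < R a) (hR : ∑ a, R a = 1) (hEig : (substM θ P).mulVec R = lam • R)
    (hμ : IsFrequencyMeasure θ P μ) (k n : ℕ) (G : List A → ℝ) :
    Tendsto (fun m => ∑ w ∈ allWords A n, avgFreq θ P R lam (m + k) w * G w) atTop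
      (nhds (∑ w ∈ allWords A n, freq θ μ w * G w)) :=
  tendsto_finsetSum _ fun w _ =>
    (((tendsto_add_atTop_iff_nat k).2 (tendsto_avgFreq h hlam hRpos hR hEig hμ w)).mul_const _)

lemma tendsto_const_div_pow (hlam : 1 < lam) (k : ℕ) (c : ℝ) :
    Tendsto (fun m : ℕ => c / lam ^ (m + k)) atTop (nhds 0) :=
  (tendsto_add_atTop_iff_nat (f := fun m => c / lam ^ m) k).2
    ((tendsto_pow_atTop_atTop_of_one_lt hlam).const_div_atTop c)

lemma sum_freq_eq_one (h : IsRandomSubstitution θ P) (hlam : 1 < lam)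
    (hRpos : ∀ a, 0 < R a) (hR : ∑ a, R a = 1) (hEig : (substM θ P).mulVec R = lam • R)
    (hμ : IsFrequencyMeasure θ P μ) (n : ℕ) : ∑ w ∈ allWords A n, freq θ μ w = 1 := by
  have hlim := tendsto_sum_avgFreq_mul h hlam hRpos hR hEig hμ 0 n (fun _ => 1)
  simp only [mul_one] at hlim
  refine tendsto_nhds_unique hlim ?_
  have hpos : ∀ K, 0 < lam ^ K := fun K => pow_pos (zero_lt_one.trans hlam) K
  have hW : ∀ m, avgExp θ P R (m + 0) (windowSum n fun _ => 1) =
      lam ^ (m + 0) * ∑ w ∈ allWords A n, avgFreq θ P R lam (m + 0) w := by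
    intro m
    simpa using avgExp_windowSum (θ := θ) (P := P) (R := R) hlam (m + 0) n (fun _ => 1)
  have hlen : ∀ m, avgExp θ P R m (fun X => (X.length : ℝ)) = lam ^ m :=
    sum_iterExp_length h hEig hR
  have hlow : Tendsto (fun m : ℕ => 1 + -(n : ℝ) / lam ^ (m + 0)) atTop (nhds 1) := by
    simpa using (tendsto_const_div_pow hlam 0 (-(n : ℝ))).const_add 1
  refine tendsto_of_tendsto_of_tendsto_of_le_of_le hlow tendsto_const_nhds
    (fun m => ?_) (fun m => ?_)
  · have h1 : avgExp θ P R (m + 0) (fun X => (X.length : ℝ) + -(n : ℝ)) ≤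
        avgExp θ P R (m + 0) (windowSum n fun _ => 1) :=
      avgExp_mono h hRpos fun X => by
        simpa [sub_eq_add_neg] using length_sub_le_windowSum_one n X
    rw [avgExp_add, avgExp_const h hR, hlen, hW] at h1
    have h2 : (1 + -(n : ℝ) / lam ^ (m + 0)) * lam ^ (m + 0) = lam ^ (m + 0) + -(n : ℝ) := by
      have := (hpos (m + 0)).ne'
      field_simp
    refine le_of_mul_le_mul_right ?_ (hpos (m + 0))
    rw [h2]
    linarith
  · have h1 : avgExp θ P R (m + 0) (windowSum n fun _ => 1) ≤
        avgExp θ P R (m + 0) (fun X => (X.length : ℝ)) :=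
      avgExp_mono h hRpos fun X => windowSum_one_le n X
    rw [hlen, hW] at h1
    exact le_of_mul_le_mul_left (by simpa using h1) (hpos (m + 0))

lemma nonempty_of_sum_eq_one (hR : ∑ a, R a = 1) : Nonempty A := by
  by_contra hA
  rw [not_nonempty_iff] at hA
  simp at hR

lemma log_four_mul_card_nonneg [Nonempty A] : 0 ≤ Real.log (4 * Fintype.card A) := by
  refine Real.log_nonneg ?_
  have : (1 : ℝ) ≤ Fintype.card A := by exact_mod_cast Fintype.card_pos
  linarith

lemma sum_exp_geometric_le {p : ℝ} (hp0 : 0 < p) (hp1 : p < 1) (T : ℕ) :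
    ∑ t ∈ Finset.range T, Real.exp (-(-Real.log p + t * -Real.log (1 - p))) ≤ 1 := by
  have hq : 0 < 1 - p := sub_pos.2 hp1
  have : ∀ t : ℕ, Real.exp (-(-Real.log p + t * -Real.log (1 - p))) = p * (1 - p) ^ t := by
    intro t
    rw [show -(-Real.log p + t * -Real.log (1 - p)) = Real.log p + t * Real.log (1 - p) by ring,
      Real.exp_add, Real.exp_log hp0, Real.exp_nat_mul, Real.exp_log hq]
  simp only [this, ← Finset.mul_sum]
  have hgeom := mul_neg_geom_sum (1 - p) T
  rw [sub_sub_cancel] at hgeom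
  rw [hgeom]
  linarith [pow_pos hq T]

/-- The lower bound for the entropy of `N + 1`-blocks. -/
lemma mul_HdotR_div_le (h : IsRandomSubstitution θ P) (hlam : 1 < lam)
    (hRpos : ∀ a, 0 < R a) (hR : ∑ a, R a = 1) (hEig : (substM θ P).mulVec R = lam • R)
    (hμ : IsFrequencyMeasure θ P μ) {k : ℕ} (hk : 1 ≤ k) (N : ℕ) :
    (N + 1 : ℝ) * (HdotR θ P R k / lam ^ k - binEnt ((lam ^ k)⁻¹)) ≤
      Real.log 4 + entropySeq θ μ (N + 1) := by
  have : Nonempty A := nonempty_of_sum_eq_one hR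
  have hc := log_four_mul_card_nonneg (A := A)
  have hpos : ∀ K, 0 < lam ^ K := fun K => pow_pos (zero_lt_one.trans hlam) K
  have hsum := sum_freq_eq_one h hlam hRpos hR hEig hμ (N + 1)
  obtain ⟨Γ, hΓ⟩ := exists_isCode (allWords A (N + 1)) (freq θ μ) (freq_nonneg μ)
    (fun s hs h0 => by simp [mem_allWords, h0] at hs) hsum.le
  set c := Real.log (4 * Fintype.card A) with hcdef
  set G : List A → ℝ := fun w => if 0 < freq θ μ w ∧ w.length = N + 1 then
    Real.log 4 - Real.log (freq θ μ w) else (N + 1) * c with hG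
  have hlog4 : 0 ≤ Real.log 4 := Real.log_nonneg (by norm_num)
  have hGnn : ∀ w, 0 ≤ G w := by
    intro w
    simp only [hG]
    split_ifs with hw
    · have hle : freq θ μ w ≤ 1 := hsum ▸ Finset.single_le_sum
        (fun v _ => freq_nonneg μ v) (mem_allWords.2 hw.2)
      linarith [Real.log_nonpos hw.1.le hle]
    · positivity
  have hΓG : ∀ w : List A, w.length = N + 1 → ∀ X, Γ (w ++ X) ≤ G w + Γ X := by
    intro w hw X
    simp only [hG]
    split_ifs with hw'
    · exact hΓ.append_le w (mem_allWords.2 hw) hw'.1 X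
    · have := hΓ.append_letters_le w X
      rwa [hw, Nat.cast_add, Nat.cast_one] at this
  set p : ℝ := (lam ^ k)⁻¹ with hp
  have hp0 : 0 < p := inv_pos.2 (hpos k)
  have hp1 : p < 1 := inv_lt_one_of_one_lt₀ (one_lt_pow₀ hlam (by omega))
  set α := -Real.log p with hα
  set β := -Real.log (1 - p) with hβ
  set C : ℝ := (N + 1) * (2 * (N + 1) * c + Real.log 2) with hC
  have hbin : binEnt p = p * α + (1 - p) * β := by
    simp only [binEnt, Real.negMulLog, hα, hβ]; ring
  have hfin : ∀ m : ℕ, (N + 1 : ℝ) * (HdotR θ P R k / lam ^ k - binEnt p) ≤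
      C / lam ^ (m + k) +
        ∑ w ∈ allWords A (N + 1), avgFreq θ P R lam (m + k) w * G w := by
    intro m
    have h1 : lam ^ m * HdotR θ P R k ≤ avgExp θ P R m (fun u => iterExp θ P k u
        (fun X => Γ X + (u.length * α + (X.length - u.length) * β))) := by
      unfold HdotR
      rw [← sum_iterExp_sum_count h hEig]
      exact avgExp_mono h hRpos fun u => sum_Hvec_le h (sum_exp_geometric_le hp0 hp1) hΓ.kraft u
    have h2 : avgExp θ P R m (fun u => iterExp θ P k u
        (fun X => Γ X + (u.length * α + (X.length - u.length) * β))) =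
        avgExp θ P R (m + k) Γ + (lam ^ m * α + (lam ^ (m + k) - lam ^ m) * β) := by
      have hinner : ∀ u : List A, iterExp θ P k u
          (fun X => Γ X + (u.length * α + (X.length - u.length) * β)) =
          iterExp θ P k u Γ + (β * iterExp θ P k u (fun X => (X.length : ℝ)) +
            (α - β) * u.length) := by
        intro u
        rw [iterExp_add, ← iterExp_mul_left, add_comm (iterExp θ P k u fun X => β * (X.length : ℝ))]
        refine congrArg (_ + ·) ?_
        rw [← iterExp_const_add h]
        exact congrArg (iterExp θ P k u) (funext fun X => by ring)
      simp only [hinner, avgExp_add, avgExp_mul_left, ← avgExp_comp]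
      have hlen : ∀ m, avgExp θ P R m (fun X => (X.length : ℝ)) = lam ^ m :=
        sum_iterExp_length h hEig hR
      rw [hlen, hlen]
      ring
    have h3 : (N + 1 : ℝ) * avgExp θ P R (m + k) Γ ≤ C + lam ^ (m + k) *
        ∑ w ∈ allWords A (N + 1), avgFreq θ P R lam (m + k) w * G w := by
      rw [← avgExp_windowSum hlam, ← avgExp_mul_left]
      conv_rhs => rw [← avgExp_const h hR (m + k) C, ← avgExp_add]
      exact avgExp_mono h hRpos fun X => hΓ.mul_le_windowSum hc N hGnn hΓG X
    have hpk : p * lam ^ k = 1 := inv_mul_cancel₀ (hpos k).ne'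
    refine le_of_mul_le_mul_right ?_ (hpos (m + k))
    have e1 : (N + 1 : ℝ) * (HdotR θ P R k / lam ^ k - binEnt p) * lam ^ (m + k) =
        (N + 1) * (lam ^ m * HdotR θ P R k -
          (lam ^ m * α + (lam ^ (m + k) - lam ^ m) * β)) := by
      have hdiv : HdotR θ P R k / lam ^ k = HdotR θ P R k * p := div_eq_mul_inv _ _
      rw [hbin, hdiv, pow_add]
      linear_combination ((N + 1 : ℝ) * lam ^ m * (HdotR θ P R k - α + β)) * hpk
    have e2 : (C / lam ^ (m + k) + ∑ w ∈ allWords A (N + 1),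
        avgFreq θ P R lam (m + k) w * G w) * lam ^ (m + k) =
        C + lam ^ (m + k) * ∑ w ∈ allWords A (N + 1), avgFreq θ P R lam (m + k) w * G w := by
      rw [add_mul, div_mul_cancel₀ _ (hpos (m + k)).ne', mul_comm (lam ^ (m + k))]
    rw [e1, e2]
    refine le_trans (mul_le_mul_of_nonneg_left ?_ (by positivity)) h3
    linarith
  have hlim := (tendsto_const_div_pow hlam k C).add
    (tendsto_sum_avgFreq_mul h hlam hRpos hR hEig hμ k (N + 1) G)
  refine (ge_of_tendsto' hlim hfin).trans (le_of_eq ?_)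
  rw [zero_add, entropySeq_eq, ← mul_one (Real.log 4), ← hsum, Finset.mul_sum,
    ← Finset.sum_add_distrib]
  refine Finset.sum_congr rfl fun w hw => ?_
  rcases (freq_nonneg (θ := θ) μ w).eq_or_lt with h0 | h0
  · simp [← h0]
  · simp only [hG, if_pos (And.intro h0 (mem_allWords.1 hw)), Real.negMulLog]
    ring

/-- The upper bound for the entropy of `n`-blocks. -/
lemma exists_entropySeq_le (h : IsRandomSubstitution θ P) (hlam : 1 < lam)
    (hRpos : ∀ a, 0 < R a) (hR : ∑ a, R a = 1) (hEig : (substM θ P).mulVec R = lam • R)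
    (hμ : IsFrequencyMeasure θ P μ) (k : ℕ) :
    ∃ (L : ℕ) (C : ℝ), ∀ n, L ≤ n → entropySeq θ μ n ≤
      n * ((Real.log (4 * Fintype.card A) + HdotR θ P R k) / lam ^ k) + C := by
  have : Nonempty A := nonempty_of_sum_eq_one hR
  have hc := log_four_mul_card_nonneg (A := A)
  have hpos : ∀ K, 0 < lam ^ K := fun K => pow_pos (zero_lt_one.trans hlam) K
  have hcard : (0 : ℝ) < Fintype.card A := by exact_mod_cast Fintype.card_pos
  set D : Finset (List A) := Finset.univ.biUnion fun a => realsIter θ k [a] with hDdef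
  set r : List A → ℝ := fun s => (∑ a, iterProb θ P k [a] s) / Fintype.card A with hr
  have hD : ∀ a, realsIter θ k [a] ⊆ D := fun a =>
    Finset.subset_biUnion_of_mem (fun a => realsIter θ k [a]) (Finset.mem_univ a)
  have hr0 : ∀ s, 0 ≤ r s := fun s =>
    div_nonneg (Finset.sum_nonneg fun a _ => iterProb_nonneg h _ _ _) hcard.le
  have hone : ∀ a, ∑ s ∈ D, iterProb θ P k [a] s = 1 := by
    intro a
    rw [← Finset.sum_subset (hD a) fun s _ hs => iterProb_eq_zero hs]
    simpa [← sum_iterProb_mul] using iterExp_one h k [a]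
  have hrsum : ∑ s ∈ D, r s ≤ 1 := by
    simp only [hr, ← Finset.sum_div]
    rw [Finset.sum_comm]
    simp [hone, hcard.ne']
  have hDne : ∀ s ∈ D, s ≠ [] := by
    intro s hs h0
    obtain ⟨a, _, hs⟩ := Finset.mem_biUnion.1 hs
    have : 1 ≤ s.length := length_le_of_mem_realsIter h.2.1 hs
    simp [h0] at this
  obtain ⟨Γ, hΓ⟩ := exists_isCode D r hr0 hDne hrsum
  set c := Real.log (4 * Fintype.card A) with hcdef
  set L : ℕ := D.sup List.length with hL
  set C : ℝ := L * (2 * L * c + Real.log 2) with hC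
  refine ⟨L, C / lam ^ k, fun n hn => ?_⟩
  have hbound : ∀ m : ℕ, ∑ w ∈ allWords A n, avgFreq θ P R lam (m + k) w * Γ w ≤
      n * Real.log 2 / lam ^ (m + k) + (n * ((c + HdotR θ P R k) / lam ^ k) + C / lam ^ k) := by
    intro m
    have h1 : avgExp θ P R (m + k) (windowSum n Γ) ≤ avgExp θ P R m (fun u => n * Real.log 2 +
        ∑ b, (u.count b : ℝ) * (n * (c + Hvec θ P k b) + C)) := by
      rw [avgExp_comp]
      refine avgExp_mono h hRpos fun u => iterExp_windowSum_le h hΓ hc hD ?_ ?_ hn u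
      · intro a s _
        exact div_le_div_of_nonneg_right (Finset.single_le_sum
          (f := fun b => iterProb θ P k [b] s) (fun b _ => iterProb_nonneg h _ _ _)
          (Finset.mem_univ a)) hcard.le
      · intro a s hs
        exact Finset.le_sup (f := List.length) (hD a hs)
    have h2 : ∑ b, (n * (c + Hvec θ P k b) + C) * R b = n * (c + HdotR θ P R k) + C := by
      have : ∀ b, (n * (c + Hvec θ P k b) + C) * R b =
          (n * c + C) * R b + n * (Hvec θ P k b * R b) := fun b => by ring
      simp only [this, Finset.sum_add_distrib, ← Finset.mul_sum, hR, HdotR]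
      ring
    have h3 : avgExp θ P R m (fun u => ∑ b, (u.count b : ℝ) * (n * (c + Hvec θ P k b) + C)) =
        lam ^ m * (n * (c + HdotR θ P R k) + C) := by
      rw [← h2]
      exact sum_iterExp_sum_count h hEig m _
    rw [avgExp_add, avgExp_const h hR, h3, avgExp_windowSum hlam] at h1
    refine le_of_mul_le_mul_left (h1.trans (le_of_eq ?_)) (hpos (m + k))
    have := (hpos m).ne'
    have := (hpos k).ne'
    rw [pow_add]
    field_simp
  have hlim := tendsto_sum_avgFreq_mul h hlam hRpos hR hEig hμ k n Γ
  have hlim' := (tendsto_const_div_pow hlam k (n * Real.log 2)).add_const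
    (n * ((c + HdotR θ P R k) / lam ^ k) + C / lam ^ k)
  rw [zero_add] at hlim'
  refine le_trans ?_ (le_of_tendsto_of_tendsto' hlim hlim' hbound)
  rw [entropySeq_eq]
  have := sum_negMulLog_le (allWords A n) (freq θ μ) (fun w => Real.exp (-Γ w))
    (fun w _ => freq_nonneg μ w) (fun w _ => Real.exp_pos _)
    (by rw [sum_freq_eq_one h hlam hRpos hR hEig hμ n]; exact hΓ.kraft _)
  simpa using this

lemma tendsto_add_div_natCast (x c : ℝ) :
    Tendsto (fun n : ℕ => x + c / (n : ℝ)) atTop (nhds x) := by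
  simpa using (tendsto_const_div_atTop_nhds_zero_nat c).const_add x

end Main

theorem statement0 {A : Type*} [Fintype A] [DecidableEq A] [MeasurableSpace A]
    (θ : A → Finset (List A)) (P : A → List A → ℝ) (lam : ℝ) (R : A → ℝ)
    (μ : Measure (ℤ → A))
    (hRS : IsRandomSubstitution θ P) (hprim : IsPrimitive θ P) (hlam : 1 < lam)
    (hRpos : ∀ a, 0 < R a) (hRsum : ∑ a, R a = 1)
    (hEig : (substM θ P).mulVec R = lam • R)
    (hμ : IsFrequencyMeasure θ P μ) :
    (∀ k : ℕ, 1 ≤ k →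
        HdotR θ P R k / lam ^ k - binEnt ((lam ^ k)⁻¹) ≤ measEntropy θ μ ∧
          measEntropy θ μ ≤ HdotR θ P R k / (lam ^ k - 1)) ∧
      Tendsto (fun k : ℕ => HdotR θ P R k / lam ^ k) atTop (nhds (measEntropy θ μ)) := by
  have hpos : ∀ K, 0 < lam ^ K := fun K => pow_pos (zero_lt_one.trans hlam) K
  set a : ℕ → ℝ := fun n => entropySeq θ μ n / (n : ℝ) with ha
  have hlow : ∀ k : ℕ, 1 ≤ k → ∀ᶠ n : ℕ in atTop,
      (HdotR θ P R k / lam ^ k - binEnt ((lam ^ k)⁻¹)) + -Real.log 4 / (n : ℝ) ≤ a n := by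
    intro k hk
    filter_upwards [eventually_ge_atTop 1] with n hn
    obtain ⟨N, rfl⟩ := Nat.exists_eq_add_of_le' hn
    have h1 := mul_HdotR_div_le hRS hlam hRpos hRsum hEig hμ hk N
    have hN : (0 : ℝ) < ((N + 1 : ℕ) : ℝ) := by positivity
    rw [ha, le_div_iff₀ hN, add_mul, div_mul_cancel₀ _ hN.ne']
    push_cast
    linarith
  have hupp : ∀ k : ℕ, ∃ C : ℝ, ∀ᶠ n : ℕ in atTop,
      a n ≤ (Real.log (4 * Fintype.card A) + HdotR θ P R k) / lam ^ k + C / (n : ℝ) := by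
    intro k
    obtain ⟨L, C, hC⟩ := exists_entropySeq_le hRS hlam hRpos hRsum hEig hμ k
    refine ⟨C, ?_⟩
    filter_upwards [eventually_ge_atTop (L + 1)] with n hn
    have hn0 : (0 : ℝ) < n := by exact_mod_cast (Nat.succ_pos L).trans_le hn
    rw [ha, div_le_iff₀ hn0, add_mul, div_mul_cancel₀ _ hn0.ne', mul_comm _ (n : ℝ)]
    exact hC n (by omega)
  have hbelow : IsBoundedUnder (· ≥ ·) atTop a :=
    (tendsto_add_div_natCast _ _).isBoundedUnder_ge.mono_ge (hlow 1 le_rfl)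
  have habove : IsBoundedUnder (· ≤ ·) atTop a := by
    obtain ⟨C, hC⟩ := hupp 0
    exact (tendsto_add_div_natCast _ _).isBoundedUnder_le.mono_le hC
  have hL : ∀ k : ℕ, 1 ≤ k →
      HdotR θ P R k / lam ^ k - binEnt ((lam ^ k)⁻¹) ≤ measEntropy θ μ := by
    intro k hk
    have hlim := tendsto_add_div_natCast
      (HdotR θ P R k / lam ^ k - binEnt ((lam ^ k)⁻¹)) (-Real.log 4)
    rw [← hlim.limsup_eq]
    exact limsup_le_limsup (hlow k hk) hlim.isBoundedUnder_ge.isCoboundedUnder_le habove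
  have hU : ∀ k : ℕ, measEntropy θ μ ≤
      (Real.log (4 * Fintype.card A) + HdotR θ P R k) / lam ^ k := by
    intro k
    obtain ⟨C, hC⟩ := hupp k
    have hlim := tendsto_add_div_natCast
      ((Real.log (4 * Fintype.card A) + HdotR θ P R k) / lam ^ k) C
    rw [← hlim.limsup_eq]
    exact limsup_le_limsup hC hbelow.isCoboundedUnder_le hlim.isBoundedUnder_le
  have hupper : ∀ k : ℕ, 1 ≤ k → measEntropy θ μ ≤ HdotR θ P R k / (lam ^ k - 1) := by
    intro k hk
    have hone : 0 < lam ^ k - 1 := sub_pos.2 (one_lt_pow₀ hlam (by omega))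
    have hnn : ∀ j, HdotR θ P R (k * j) ≤
        (lam ^ (k * j) - 1) * (HdotR θ P R k / (lam ^ k - 1)) := by
      intro j
      induction j with
      | zero => simp [HdotR, Hvec, realsIter, iterProb]
      | succ j ih =>
        have h1 := HdotR_add_le hRS hEig hRpos (k * j) k
        have h2 : HdotR θ P R k = (lam ^ k - 1) * (HdotR θ P R k / (lam ^ k - 1)) := by
          rw [mul_div_cancel₀ _ hone.ne']
        rw [Nat.mul_succ]
        set y := HdotR θ P R k / (lam ^ k - 1)
        rw [h2] at h1
        rw [pow_add]
        linarith
    set y := HdotR θ P R k / (lam ^ k - 1)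
    have hy : ∀ j : ℕ, measEntropy θ μ ≤
        y + (Real.log (4 * Fintype.card A) - y) / lam ^ (k * j) := by
      intro j
      refine (hU (k * j)).trans ?_
      rw [div_le_iff₀ (hpos _), add_mul, div_mul_cancel₀ _ (hpos _).ne']
      linarith [hnn j]
    have hlim : Tendsto (fun j : ℕ => y + (Real.log (4 * Fintype.card A) - y) / lam ^ (k * j))
        atTop (nhds (y + 0)) := by
      refine ((Tendsto.const_div_atTop ?_ _)).const_add y
      simp only [pow_mul]
      exact tendsto_pow_atTop_atTop_of_one_lt (one_lt_pow₀ hlam (by omega))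
    rw [add_zero] at hlim
    exact ge_of_tendsto' hlim hy
  refine ⟨fun k hk => ⟨hL k hk, hupper k hk⟩, ?_⟩
  have hinv : Tendsto (fun k : ℕ => (lam ^ k)⁻¹) atTop (nhds 0) :=
    (tendsto_pow_atTop_atTop_of_one_lt hlam).inv_tendsto_atTop
  have hbin : Tendsto (fun k : ℕ => binEnt ((lam ^ k)⁻¹)) atTop (nhds 0) := by
    have hcont : Continuous binEnt :=
      Real.continuous_negMulLog.add (Real.continuous_negMulLog.comp (continuous_const.sub
        continuous_id))
    have hzero : binEnt 0 = 0 := by simp [binEnt]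
    have := (hcont.tendsto 0).comp hinv
    rwa [hzero] at this
  have hlo : Tendsto (fun k : ℕ => measEntropy θ μ - measEntropy θ μ * (lam ^ k)⁻¹) atTop
      (nhds (measEntropy θ μ)) := by
    simpa using (hinv.const_mul (measEntropy θ μ)).const_sub (measEntropy θ μ)
  have hhi : Tendsto (fun k : ℕ => measEntropy θ μ + binEnt ((lam ^ k)⁻¹)) atTop
      (nhds (measEntropy θ μ)) := by
    simpa using hbin.const_add (measEntropy θ μ)
  refine tendsto_of_tendsto_of_tendsto_of_le_of_le' hlo hhi ?_ ?_
  · filter_upwards [eventually_ge_atTop 1] with k hk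
    have hone : 0 < lam ^ k - 1 := sub_pos.2 (one_lt_pow₀ hlam (by omega))
    have h1 := (le_div_iff₀ hone).1 (hupper k hk)
    rw [le_div_iff₀ (hpos k), sub_mul, mul_assoc, inv_mul_cancel₀ (hpos k).ne']
    linarith
  · filter_upwards [eventually_ge_atTop 1] with k hk
    linarith [hL k hk]

end RandomSubstitutionTheory
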